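/- arXiv:math/0701016 — 3 statements merged into one kernel-verified Lean document; each statement's English description precedes it below -/
import Mathlib

section
/- There is no finite simple graph G whose circular chromatic index lies strictly between 11/3 and 4. Equivalently: for every finite simple graph G, if there exist positive integers p, q with p < 4q such that the line graph L(G) admits a (p,q)-coloring, then L(G) admits an (11,3)-coloring. -/
open SimpleGraph

/-- A `(p,q)`-coloring of a simple graph `H`: a function into `{0,...,p-1}` such that
adjacent vertices `x, y` satisfy `q ≤ |f x - f y| ≤ p - q`. -/
def IsPQColoring {V : Type*} (H : SimpleGraph V) (p q : ℕ) (f : V → ℕ) : Prop :=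
  (∀ v, f v < p) ∧
    ∀ x y, H.Adj x y → (q : ℤ) ≤ |(f x : ℤ) - (f y : ℤ)| ∧ |(f x : ℤ) - (f y : ℤ)| ≤ (p : ℤ) - q

set_option linter.unusedVariables false

namespace CCI

/-- Maximum degree at most three. -/
def Subcubic {V : Type*} (G : SimpleGraph V) : Prop :=
  ∀ v x y z w, G.Adj v x → G.Adj v y → G.Adj v z → G.Adj v w →
    x = y ∨ x = z ∨ x = w ∨ y = z ∨ y = w ∨ z = w

/-- At least three distinct neighbours. -/
def Has3 {V : Type*} (G : SimpleGraph V) (v : V) : Prop :=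
  ∃ x y z, G.Adj v x ∧ G.Adj v y ∧ G.Adj v z ∧ x ≠ y ∧ x ≠ z ∧ y ≠ z

/-- No copy of `K₄` with one edge subdivided. -/
def NoH2 {V : Type*} (G : SimpleGraph V) : Prop :=
  ∀ a b c d s, G.Adj a b → G.Adj c a → G.Adj c b → G.Adj d a → G.Adj d b → G.Adj c s →
    G.Adj d s → c ≠ d → s ≠ a → s ≠ b → False

/-- Colors far apart on the circle of length `11`. -/
def Sep (a b : ℕ) : Prop := (a + 3 ≤ b ∧ b ≤ a + 8) ∨ (b + 3 ≤ a ∧ a ≤ b + 8)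

/-- The `(11,3)`-edge-colorability. -/
def Good {V : Type*} (G : SimpleGraph V) : Prop :=
  ∃ f : Sym2 V → ℕ, (∀ e, f e < 11) ∧
    ∀ x y z, G.Adj x y → G.Adj x z → y ≠ z → Sep (f s(x, y)) (f s(x, z))

/-- Every edge cut with an edge has at least two edges. -/
def Bridgeless {V : Type*} (G : SimpleGraph V) : Prop :=
  ∀ (S : Set V) (u v : V), u ∈ S → v ∉ S → G.Adj u v →
    ∃ x y, x ∈ S ∧ y ∉ S ∧ G.Adj x y ∧ ¬ (x = u ∧ y = v)

/-! ### From the hypothesis to the structural conditions -/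

lemma four_impossible (p q a b c d : ℤ) (hq : 0 < q) (hp : p < 4 * q)
    (a1 : a < p) (a0 : 0 ≤ a) (b1 : b < p) (b0 : 0 ≤ b)
    (c1 : c < p) (c0 : 0 ≤ c) (d1 : d < p) (d0 : 0 ≤ d)
    (hab : q ≤ |a - b| ∧ |a - b| ≤ p - q)
    (hac : q ≤ |a - c| ∧ |a - c| ≤ p - q)
    (had : q ≤ |a - d| ∧ |a - d| ≤ p - q)
    (hbc : q ≤ |b - c| ∧ |b - c| ≤ p - q)
    (hbd : q ≤ |b - d| ∧ |b - d| ≤ p - q)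
    (hcd : q ≤ |c - d| ∧ |c - d| ≤ p - q) : False := by
  rcases abs_cases (a - b) with ⟨h1, _⟩ | ⟨h1, _⟩ <;> rw [h1] at hab <;> clear h1 <;>
  rcases abs_cases (a - c) with ⟨h1, _⟩ | ⟨h1, _⟩ <;> rw [h1] at hac <;> clear h1 <;>
  rcases abs_cases (a - d) with ⟨h1, _⟩ | ⟨h1, _⟩ <;> rw [h1] at had <;> clear h1 <;>
  rcases abs_cases (b - c) with ⟨h1, _⟩ | ⟨h1, _⟩ <;> rw [h1] at hbc <;> clear h1 <;>
  rcases abs_cases (b - d) with ⟨h1, _⟩ | ⟨h1, _⟩ <;> rw [h1] at hbd <;> clear h1 <;>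
  rcases abs_cases (c - d) with ⟨h1, _⟩ | ⟨h1, _⟩ <;> rw [h1] at hcd <;> clear h1 <;>
  omega

/-- Circular distance at least `q` on the circle of length `p`, for values in `[0,p)`. -/
def CD (p q x y : ℤ) : Prop := (q ≤ x - y ∧ x - y ≤ p - q) ∨ (q ≤ y - x ∧ y - x ≤ p - q)

lemma CD_of_abs {p q x y : ℤ} (h : q ≤ |x - y| ∧ |x - y| ≤ p - q) : CD p q x y := by
  unfold CD
  rcases abs_cases (x - y) with ⟨h1, _⟩ | ⟨h1, _⟩ <;> rw [h1] at h <;> omega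

lemma CD_shift {p q x y t : ℤ} (hx : 0 ≤ x ∧ x < p) (hy : 0 ≤ y ∧ y < p) (ht : 0 ≤ t ∧ t < p)
    (h : CD p q x y) :
    CD p q (if t ≤ x then x - t else x - t + p) (if t ≤ y then y - t else y - t + p) := by
  unfold CD at *
  split_ifs <;> omega

lemma shift_range {p x t : ℤ} (hx : 0 ≤ x ∧ x < p) (ht : 0 ≤ t ∧ t < p) :
    0 ≤ (if t ≤ x then x - t else x - t + p) ∧ (if t ≤ x then x - t else x - t + p) < p := by
  split_ifs <;> omega

/-- Normalized version: the edge `ab` has color `0`. -/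
lemma H2_impossible0 (p q ca cb da db cs ds : ℤ) (hq : 0 < q) (hp : p < 4 * q)
    (rca : 0 ≤ ca ∧ ca < p) (rcb : 0 ≤ cb ∧ cb < p) (rda : 0 ≤ da ∧ da < p)
    (rdb : 0 ≤ db ∧ db < p) (rcs : 0 ≤ cs ∧ cs < p) (rds : 0 ≤ ds ∧ ds < p)
    (h1 : CD p q ca 0) (h2 : CD p q cb 0) (h3 : CD p q da 0) (h4 : CD p q db 0)
    (h5 : CD p q ca cb) (h6 : CD p q ca da) (h7 : CD p q cb db) (h8 : CD p q da db)
    (h9 : CD p q cs ca) (h10 : CD p q cs cb) (h11 : CD p q ds da) (h12 : CD p q ds db)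
    (h13 : CD p q cs ds) : False := by
  have k1 : q ≤ ca ∧ ca ≤ p - q := by unfold CD at h1; omega
  have k2 : q ≤ cb ∧ cb ≤ p - q := by unfold CD at h2; omega
  have k3 : q ≤ da ∧ da ≤ p - q := by unfold CD at h3; omega
  have k4 : q ≤ db ∧ db ≤ p - q := by unfold CD at h4; omega
  clear h1 h2 h3 h4
  have key : ∀ ca cb da db cs ds : ℤ, (q ≤ ca ∧ ca ≤ p - q) → (q ≤ cb ∧ cb ≤ p - q) →
      (q ≤ da ∧ da ≤ p - q) → (q ≤ db ∧ db ≤ p - q) →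
      (0 ≤ cs ∧ cs < p) → (0 ≤ ds ∧ ds < p) →
      CD p q ca cb → CD p q ca da → CD p q cb db → CD p q da db → CD p q cs ca → CD p q cs cb →
      CD p q ds da → CD p q ds db → CD p q cs ds → ca ≤ cb → False := by
    clear * - hq hp
    intro ca cb da db cs ds k1 k2 k3 k4 rcs rds h5 h6 h7 h8 h9 h10 h11 h12 h13 hle
    have m1 : ca + q ≤ cb := by unfold CD at h5; omega
    have m2 : ca + q ≤ da := by unfold CD at h6; omega
    have m3 : db + q ≤ cb := by unfold CD at h7; omega
    have m4 : db + q ≤ da := by unfold CD at h8; omega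
    have m5 : cs + q ≤ ca ∨ cb + q ≤ cs := by unfold CD at h9 h10; omega
    have m6 : ds + q ≤ db ∨ da + q ≤ ds := by unfold CD at h11 h12; omega
    unfold CD at *
    omega
  rcases le_total ca cb with hle | hle
  · exact key ca cb da db cs ds k1 k2 k3 k4 rcs rds h5 h6 h7 h8 h9 h10 h11 h12 h13 hle
  · exact key cb ca db da cs ds k2 k1 k4 k3 rcs rds (by unfold CD at *; omega) h7 h6
      (by unfold CD at *; omega) h10 h9 h12 h11 h13 hle

lemma H2_impossible (p q ab ca cb da db cs ds : ℤ) (hq : 0 < q) (hp : p < 4 * q)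
    (rab : 0 ≤ ab ∧ ab < p)
    (rca : 0 ≤ ca ∧ ca < p) (rcb : 0 ≤ cb ∧ cb < p) (rda : 0 ≤ da ∧ da < p)
    (rdb : 0 ≤ db ∧ db < p) (rcs : 0 ≤ cs ∧ cs < p) (rds : 0 ≤ ds ∧ ds < p)
    (h1 : CD p q ca ab) (h2 : CD p q cb ab) (h3 : CD p q da ab) (h4 : CD p q db ab)
    (h5 : CD p q ca cb) (h6 : CD p q ca da) (h7 : CD p q cb db) (h8 : CD p q da db)
    (h9 : CD p q cs ca) (h10 : CD p q cs cb) (h11 : CD p q ds da) (h12 : CD p q ds db)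
    (h13 : CD p q cs ds) : False := by
  have z : (if ab ≤ ab then ab - ab else ab - ab + p) = 0 := by simp
  refine H2_impossible0 p q _ _ _ _ _ _ hq hp (shift_range rca rab) (shift_range rcb rab)
    (shift_range rda rab) (shift_range rdb rab) (shift_range rcs rab) (shift_range rds rab)
    (z ▸ CD_shift rca rab rab h1) (z ▸ CD_shift rcb rab rab h2) (z ▸ CD_shift rda rab rab h3)
    (z ▸ CD_shift rdb rab rab h4) (CD_shift rca rcb rab h5) (CD_shift rca rda rab h6)
    (CD_shift rcb rdb rab h7) (CD_shift rda rdb rab h8) (CD_shift rcs rca rab h9)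
    (CD_shift rcs rcb rab h10) (CD_shift rds rda rab h11) (CD_shift rds rdb rab h12)
    (CD_shift rcs rds rab h13)

lemma lineGraph_sep {V : Type*} {G : SimpleGraph V} {p q : ℕ} {f : G.edgeSet → ℕ}
    (hf : IsPQColoring G.lineGraph p q f) {x y z : V} (hxy : G.Adj x y) (hxz : G.Adj x z)
    (hyz : y ≠ z) :
    (q : ℤ) ≤ |(f ⟨s(x, y), hxy⟩ : ℤ) - (f ⟨s(x, z), hxz⟩ : ℤ)| ∧
      |(f ⟨s(x, y), hxy⟩ : ℤ) - (f ⟨s(x, z), hxz⟩ : ℤ)| ≤ (p : ℤ) - q := by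
  apply hf.2
  rw [SimpleGraph.lineGraph_adj_iff_exists]
  refine ⟨?_, x, by simp⟩
  intro h
  have := congrArg Subtype.val h
  simp only [Sym2.eq_iff] at this
  grind

/-- A total version of a coloring of the line graph. -/
lemma exists_total {V : Type*} {G : SimpleGraph V} {p q : ℕ} (hp : 0 < p) {f : G.edgeSet → ℕ}
    (hf : IsPQColoring G.lineGraph p q f) :
    ∃ g : Sym2 V → ℤ, (∀ e, 0 ≤ g e ∧ g e < p) ∧ ∀ x y z, G.Adj x y → G.Adj x z → y ≠ z →
      (q : ℤ) ≤ |g s(x, y) - g s(x, z)| ∧ |g s(x, y) - g s(x, z)| ≤ (p : ℤ) - q := by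
  classical
  refine ⟨fun e => if h : e ∈ G.edgeSet then (f ⟨e, h⟩ : ℤ) else 0, ?_, ?_⟩
  · intro e
    have := hf.1
    dsimp only
    split_ifs with h
    · have := this ⟨e, h⟩
      omega
    · omega
  · intro x y z hxy hxz hyz
    have h1 : s(x, y) ∈ G.edgeSet := hxy
    have h2 : s(x, z) ∈ G.edgeSet := hxz
    simp only [h1, h2, dif_pos]
    exact lineGraph_sep hf hxy hxz hyz

lemma subcubic_of_coloring {V : Type*} {G : SimpleGraph V} {p q : ℕ} (hq : 0 < q)
    (hpq : p < 4 * q) {g : Sym2 V → ℤ} (hr : ∀ e, 0 ≤ g e ∧ g e < p)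
    (hg : ∀ x y z, G.Adj x y → G.Adj x z → y ≠ z →
      (q : ℤ) ≤ |g s(x, y) - g s(x, z)| ∧ |g s(x, y) - g s(x, z)| ≤ (p : ℤ) - q) :
    Subcubic G := by
  intro v x y z w hx hy hz hw
  by_contra hcon
  push Not at hcon
  obtain ⟨h1, h2, h3, h4, h5, h6⟩ := hcon
  exact four_impossible p q _ _ _ _ (by omega) (by omega) (hr s(v, x)).2 (hr _).1 (hr s(v, y)).2
    (hr _).1 (hr s(v, z)).2 (hr _).1 (hr s(v, w)).2 (hr _).1 (hg _ _ _ hx hy h1) (hg _ _ _ hx hz h2)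
    (hg _ _ _ hx hw h3) (hg _ _ _ hy hz h4) (hg _ _ _ hy hw h5) (hg _ _ _ hz hw h6)

lemma noH2_of_coloring {V : Type*} {G : SimpleGraph V} {p q : ℕ} (hq : 0 < q)
    (hpq : p < 4 * q) {g : Sym2 V → ℤ} (hr : ∀ e, 0 ≤ g e ∧ g e < p)
    (hg : ∀ x y z, G.Adj x y → G.Adj x z → y ≠ z →
      (q : ℤ) ≤ |g s(x, y) - g s(x, z)| ∧ |g s(x, y) - g s(x, z)| ≤ (p : ℤ) - q) :
    NoH2 G := by
  intro a b c d s hab hca hcb hda hdb hcs hds hcd hsa hsb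
  have hg' : ∀ x y z, G.Adj x y → G.Adj x z → y ≠ z → CD p q (g s(x, y)) (g s(x, z)) :=
    fun x y z h1 h2 h3 => CD_of_abs (hg x y z h1 h2 h3)
  have e1 : g s(a, c) = g s(c, a) := by rw [Sym2.eq_swap]
  have e2 : g s(b, c) = g s(c, b) := by rw [Sym2.eq_swap]
  have e3 : g s(a, d) = g s(d, a) := by rw [Sym2.eq_swap]
  have e4 : g s(b, d) = g s(d, b) := by rw [Sym2.eq_swap]
  have e5 : g s(b, a) = g s(a, b) := by rw [Sym2.eq_swap]
  have e6 : g s(s, c) = g s(c, s) := by rw [Sym2.eq_swap]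
  have e7 : g s(s, d) = g s(d, s) := by rw [Sym2.eq_swap]
  refine H2_impossible p q (g s(a, b)) (g s(c, a)) (g s(c, b)) (g s(d, a)) (g s(d, b)) (g s(c, s))
    (g s(d, s)) (by omega) (by omega) (hr _) (hr _) (hr _) (hr _) (hr _) (hr _) (hr _)
    ?_ ?_ ?_ ?_ ?_ ?_ ?_ ?_ ?_ ?_ ?_ ?_ ?_
  · rw [← e1]; exact hg' _ _ _ hca.symm hab hcb.ne
  · rw [← e2, ← e5]; exact hg' _ _ _ hcb.symm hab.symm hca.ne
  · rw [← e3]; exact hg' _ _ _ hda.symm hab hdb.ne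
  · rw [← e4, ← e5]; exact hg' _ _ _ hdb.symm hab.symm hda.ne
  · exact hg' _ _ _ hca hcb hab.ne
  · rw [← e1, ← e3]; exact hg' _ _ _ hca.symm hda.symm hcd
  · rw [← e2, ← e4]; exact hg' _ _ _ hcb.symm hdb.symm hcd
  · exact hg' _ _ _ hda hdb hab.ne
  · exact hg' _ _ _ hcs hca hsa
  · exact hg' _ _ _ hcs hcb hsb
  · exact hg' _ _ _ hds hda hsa
  · exact hg' _ _ _ hds hdb hsb
  · rw [← e6, ← e7]; exact hg' _ _ _ hcs.symm hds.symm hcd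

/-! ### Bridges -/

lemma sep_symm {a b : ℕ} (h : Sep a b) : Sep b a := by unfold Sep at *; omega

lemma sep_shift {a b t : ℕ} (ha : a < 11) (hb : b < 11) (h : Sep a b) :
    Sep ((a + t) % 11) ((b + t) % 11) := by unfold Sep at *; omega

lemma exists_third {a b : ℕ} (ha : a < 11) (hb : b < 11) (h : a = b ∨ Sep a b) :
    ∃ c, c < 11 ∧ Sep c a ∧ Sep c b := by
  have key : ∀ a b : Fin 11, (a.1 = b.1 ∨ ((a.1 + 3 ≤ b.1 ∧ b.1 ≤ a.1 + 8) ∨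
      (b.1 + 3 ≤ a.1 ∧ a.1 ≤ b.1 + 8))) → ∃ c : Fin 11,
      ((c.1 + 3 ≤ a.1 ∧ a.1 ≤ c.1 + 8) ∨ (a.1 + 3 ≤ c.1 ∧ c.1 ≤ a.1 + 8)) ∧
      ((c.1 + 3 ≤ b.1 ∧ b.1 ≤ c.1 + 8) ∨ (b.1 + 3 ≤ c.1 ∧ c.1 ≤ b.1 + 8)) := by decide
  obtain ⟨c, h1, h2⟩ := key ⟨a, ha⟩ ⟨b, hb⟩ h
  exact ⟨c.1, c.2, h1, h2⟩

lemma exists_free {V : Type*} {G : SimpleGraph V} (hG : Subcubic G) {f : Sym2 V → ℕ}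
    (hf : ∀ e, f e < 11) {u v : V} (huv : G.Adj u v)
    (hs : ∀ y z, G.Adj u y → G.Adj u z → y ≠ v → z ≠ v → y ≠ z → Sep (f s(u, y)) (f s(u, z))) :
    ∃ c, c < 11 ∧ ∀ y, G.Adj u y → y ≠ v → Sep c (f s(u, y)) := by
  by_cases h1 : ∃ y, G.Adj u y ∧ y ≠ v
  · obtain ⟨y, hy, hyv⟩ := h1
    by_cases h2 : ∃ z, G.Adj u z ∧ z ≠ v ∧ z ≠ y
    · obtain ⟨z, hz, hzv, hzy⟩ := h2
      obtain ⟨c, hc, h3, h4⟩ := exists_third (hf s(u, y)) (hf s(u, z))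
        (Or.inr (hs y z hy hz hyv hzv hzy.symm))
      refine ⟨c, hc, fun w hw hwv => ?_⟩
      have := hG u v y z w huv hy hz hw
      have : w = y ∨ w = z := by grind
      rcases this with rfl | rfl <;> assumption
    · push Not at h2
      obtain ⟨c, hc, h3, h4⟩ := exists_third (hf s(u, y)) (hf s(u, y)) (Or.inl rfl)
      refine ⟨c, hc, fun w hw hwv => ?_⟩
      rw [h2 w hw hwv]; exact h3
  · push Not at h1
    exact ⟨0, by norm_num, fun y hy hyv => absurd (h1 y hy) hyv⟩

lemma good_of_bridge {V : Type*} {G : SimpleGraph V} (hG : Subcubic G) (S : Set V) (u v : V)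
    (hu : u ∈ S) (hv : v ∉ S) (huv : G.Adj u v)
    (hcut : ∀ x y, x ∈ S → y ∉ S → G.Adj x y → x = u ∧ y = v)
    (hgood : Good (G.deleteEdges {s(u, v)})) : Good G := by
  classical
  obtain ⟨f, hf, hsep⟩ := hgood
  have adj' : ∀ x y, (G.deleteEdges {s(u, v)}).Adj x y ↔ G.Adj x y ∧ s(x, y) ≠ s(u, v) := by
    intro x y; simp [SimpleGraph.deleteEdges_adj]
  obtain ⟨α, hα, hα'⟩ := exists_free hG hf huv (by
    intro y z hy hz hyv hzv hyz
    refine hsep u y z ((adj' _ _).2 ⟨hy, ?_⟩) ((adj' _ _).2 ⟨hz, ?_⟩) hyz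
    · rw [Ne, Sym2.eq_iff]; grind
    · rw [Ne, Sym2.eq_iff]; grind)
  obtain ⟨β, hβ, hβ'⟩ := exists_free hG hf huv.symm (by
    intro y z hy hz hyv hzv hyz
    refine hsep v y z ((adj' _ _).2 ⟨hy, ?_⟩) ((adj' _ _).2 ⟨hz, ?_⟩) hyz
    · rw [Ne, Sym2.eq_iff]; grind
    · rw [Ne, Sym2.eq_iff]; grind)
  set g : Sym2 V → ℕ := fun e => if e = s(u, v) then α else
    if ∀ x ∈ e, x ∉ S then (f e + (α + 11 - β)) % 11 else f e with hg
  have guv : g s(u, v) = α := by simp [hg]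
  have gS : ∀ x y, x ∈ S → s(x, y) ≠ s(u, v) → g s(x, y) = f s(x, y) := by
    intro x y hx hne
    simp only [hg, if_neg hne]
    rw [if_neg]
    intro h; exact h x (by simp) hx
  have gN : ∀ x y, x ∉ S → y ∉ S → s(x, y) ≠ s(u, v) →
      g s(x, y) = (f s(x, y) + (α + 11 - β)) % 11 := by
    intro x y hx hy hne
    simp only [hg, if_neg hne]
    rw [if_pos]
    intro z hz
    rcases Sym2.mem_iff.1 hz with rfl | rfl <;> assumption
  have hαβ : (β + (α + 11 - β)) % 11 = α := by omega
  have main : ∀ x y z, G.Adj x y → G.Adj x z → y ≠ z → s(x, z) ≠ s(u, v) →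
      Sep (g s(x, y)) (g s(x, z)) := by
    intro x y z hxy hxz hyz hz
    by_cases hx : x ∈ S
    · rw [gS x z hx hz]
      by_cases hy : s(x, y) = s(u, v)
      · have hxu : x = u ∧ y = v := by
          rw [Sym2.eq_iff] at hy
          rcases hy with h | h
          · exact h
          · exact absurd (h.1 ▸ hx) hv
        obtain ⟨rfl, rfl⟩ := hxu
        rw [guv]
        exact hα' z hxz hyz.symm
      · rw [gS x y hx hy]
        exact hsep x y z ((adj' _ _).2 ⟨hxy, hy⟩) ((adj' _ _).2 ⟨hxz, hz⟩) hyz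
    · have hzS : z ∉ S := by
        intro hzS
        obtain ⟨rfl, rfl⟩ := hcut z x hzS hx hxz.symm
        exact hz Sym2.eq_swap
      rw [gN x z hx hzS hz]
      by_cases hy : s(x, y) = s(u, v)
      · have hxu : x = v ∧ y = u := by
          rw [Sym2.eq_iff] at hy
          rcases hy with h | h
          · exact absurd (h.1 ▸ hu) hx
          · exact h
        obtain ⟨rfl, rfl⟩ := hxu
        rw [hy, guv]
        have h1 := hβ' z hxz hyz.symm
        have h2 := sep_shift (t := α + 11 - β) hβ (hf _) h1
        rwa [hαβ] at h2
      · have hyS : y ∉ S := by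
          intro hyS
          obtain ⟨rfl, rfl⟩ := hcut y x hyS hx hxy.symm
          exact hy Sym2.eq_swap
        rw [gN x y hx hyS hy]
        exact sep_shift (hf _) (hf _)
          (hsep x y z ((adj' _ _).2 ⟨hxy, hy⟩) ((adj' _ _).2 ⟨hxz, hz⟩) hyz)
  refine ⟨g, ?_, ?_⟩
  · intro e
    simp only [hg]
    split_ifs
    · exact hα
    · omega
    · exact hf e
  · intro x y z hxy hxz hyz
    by_cases hz : s(x, z) = s(u, v)
    · refine sep_symm (main x z y hxz hxy hyz.symm ?_)
      intro h
      rw [← hz] at h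
      rw [Sym2.eq_iff] at h
      grind
    · exact main x y z hxy hxz hyz hz

/-! ### Orienting graphs of maximum degree two -/

/-- `R` is an orientation of `F` with in- and out-degrees at most one. -/
structure IsOrient {V : Type*} (F : SimpleGraph V) (R : V → V → Prop) : Prop where
  adj : ∀ x y, F.Adj x y ↔ R x y ∨ R y x
  asymm : ∀ x y, R x y → ¬ R y x
  out : ∀ x y z, R x y → R x z → y = z
  inj : ∀ x y z, R x z → R y z → x = y

lemma IsOrient.flip {V : Type*} {F : SimpleGraph V} {R : V → V → Prop} (h : IsOrient F R) :
    IsOrient F (fun x y => R y x) :=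
  ⟨fun x y => by rw [h.adj x y, or_comm], fun x y h1 h2 => h.asymm _ _ h1 h2,
    fun x y z h1 h2 => h.inj _ _ _ h1 h2, fun x y z h1 h2 => h.out _ _ _ h1 h2⟩

/-- Reverse the orientation on the component of a source. -/
lemma IsOrient.reverse {V : Type*} {F : SimpleGraph V} {R : V → V → Prop} (h : IsOrient F R)
    (x : V) (hx : ∀ w, ¬ R w x) :
    ∃ R', IsOrient F R' ∧ (∀ w, ¬ R' x w) ∧ ∀ y, y ≠ x → (∀ w, ¬ R w y) → ∀ w, ¬ R' w y := by
  set S : V → Prop := fun w => Relation.ReflTransGen R x w with hS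
  have fwd : ∀ a b, R a b → S a → S b := fun a b hab ha => Relation.ReflTransGen.tail ha hab
  have bwd : ∀ a b, R a b → S b → S a := by
    intro a b hab hb
    rcases Relation.ReflTransGen.cases_tail hb with h1 | ⟨c, hc, hcb⟩
    · subst h1; exact absurd hab (hx a)
    · rw [h.inj a c b hab hcb]; exact hc
  have xS : S x := Relation.ReflTransGen.refl
  have src : ∀ y, y ≠ x → (∀ w, ¬ R w y) → ¬ S y := by
    intro y hy hw hb
    rcases Relation.ReflTransGen.cases_tail hb with h1 | ⟨c, hc, hcb⟩
    · exact hy h1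
    · exact hw c hcb
  have h1 := h.adj
  have h2 := h.asymm
  have h3 := h.out
  have h4 := h.inj
  clear_value S
  refine ⟨fun a b => (S a ∧ R b a) ∨ (¬ S a ∧ R a b), ⟨?_, ?_, ?_, ?_⟩, ?_, ?_⟩
  · intro a b; rw [h1 a b]; grind
  · grind
  · grind
  · grind
  · grind
  · grind

lemma IsOrient.add {V : Type*} {F F' : SimpleGraph V} {R : V → V → Prop} (h : IsOrient F R)
    (x y : V) (hxy : x ≠ y) (hx : ∀ w, ¬ R x w) (hy : ∀ w, ¬ R w y) (hn : ¬ F.Adj x y)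
    (hF : ∀ a b, F'.Adj a b ↔ F.Adj a b ∨ (a = x ∧ b = y) ∨ (a = y ∧ b = x)) :
    ∃ R', IsOrient F' R' := by
  have h1 := h.adj
  have h2 := h.asymm
  have h3 := h.out
  have h4 := h.inj
  refine ⟨fun a b => R a b ∨ (a = x ∧ b = y), ⟨?_, ?_, ?_, ?_⟩⟩
  · intro a b; rw [hF a b, h1 a b]; grind
  · grind
  · grind
  · grind

lemma exists_orient {V : Type*} [Finite V] (n : ℕ) : ∀ (F : SimpleGraph V), F.edgeSet.ncard = n →
    (∀ v x y z, F.Adj v x → F.Adj v y → F.Adj v z → x = y ∨ x = z ∨ y = z) →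
    ∃ R, IsOrient F R := by
  induction n with
  | zero =>
    intro F hF _
    rw [Set.ncard_eq_zero, SimpleGraph.edgeSet_eq_empty] at hF
    subst hF
    exact ⟨fun _ _ => False, ⟨by simp, by simp, by simp, by simp⟩⟩
  | succ n ih =>
    intro F hF hdeg
    obtain ⟨e, he⟩ : F.edgeSet.Nonempty := by
      apply Set.nonempty_of_ncard_ne_zero; omega
    induction e using Sym2.ind with
    | _ x y =>
    have hxy : F.Adj x y := he
    set F0 := F.deleteEdges {s(x, y)} with hF0
    have adj0 : ∀ a b, F0.Adj a b ↔ F.Adj a b ∧ ¬ ((a = x ∧ b = y) ∨ (a = y ∧ b = x)) := by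
      intro a b; simp [hF0, SimpleGraph.deleteEdges_adj]
    have hcard : F0.edgeSet.ncard = n := by
      rw [hF0, SimpleGraph.edgeSet_deleteEdges, Set.ncard_sdiff_singleton_of_mem he, hF]
      simp
    obtain ⟨R, hR⟩ := ih F0 hcard (by
      intro v a b c ha hb hc
      exact hdeg v a b c ((adj0 _ _).1 ha).1 ((adj0 _ _).1 hb).1 ((adj0 _ _).1 hc).1)
    have hadj : ∀ a b, F.Adj a b ↔ F0.Adj a b ∨ (a = x ∧ b = y) ∨ (a = y ∧ b = x) := by
      intro a b
      rw [adj0]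
      constructor
      · tauto
      · rintro (h | ⟨rfl, rfl⟩ | ⟨rfl, rfl⟩)
        · exact h.1
        · exact hxy
        · exact hxy.symm
    have hadj' : ∀ a b, F.Adj a b ↔ F0.Adj a b ∨ (a = y ∧ b = x) ∨ (a = x ∧ b = y) := by
      intro a b; rw [hadj]; tauto
    have hn : ¬ F0.Adj x y := by rw [adj0]; tauto
    have hn' : ¬ F0.Adj y x := by rw [adj0]; tauto
    have half : ∀ v w, F.Adj v w → ¬ F0.Adj v w → (∀ w, ¬ R v w) ∨ (∀ w, ¬ R w v) := by
      intro v w hvw hvw0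
      by_contra hcon
      push Not at hcon
      obtain ⟨⟨a, ha⟩, ⟨b, hb⟩⟩ := hcon
      have a1 := (hR.adj v a).2 (Or.inl ha)
      have b1 := (hR.adj v b).2 (Or.inr hb)
      have := hdeg v w a b hvw ((adj0 _ _).1 a1).1 ((adj0 _ _).1 b1).1
      rcases this with h | h | h
      · subst h; exact hvw0 a1
      · subst h; exact hvw0 b1
      · subst h; exact hR.asymm _ _ ha hb
    have both : ∀ R, IsOrient F0 R → (∀ w, ¬ R w x) → (∀ w, ¬ R w y) → ∃ R, IsOrient F R := by
      intro R hR h1 h2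
      obtain ⟨R', hR', h3, h4⟩ := hR.reverse x h1
      exact hR'.add x y hxy.ne h3 (h4 y hxy.ne.symm h2) hn hadj
    rcases half x y hxy hn with h1 | h1 <;> rcases half y x hxy.symm hn' with h2 | h2
    · exact both _ hR.flip h1 h2
    · exact hR.add x y hxy.ne h1 h2 hn hadj
    · exact hR.add y x hxy.ne.symm h2 h1 hn' hadj'
    · exact both _ hR h1 h2

lemma IsOrient.exists_perm {V : Type*} [Finite V] {F : SimpleGraph V} {R : V → V → Prop}
    (h : IsOrient F R) : ∃ σ : Equiv.Perm V, ∀ x y, R x y → σ x = y := by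
  classical
  cases nonempty_fintype V
  choose! g hg using (fun x (hx : ∃ y, R x y) => hx)
  have hinj : ∀ x y, R x y → g x = y := fun x y hxy => h.out _ _ _ (hg x ⟨y, hxy⟩) hxy
  let e : {x // ∃ y, R x y} ≃ {y // ∃ x, R x y} :=
    Equiv.ofBijective (fun x => ⟨g x.1, x.1, hg _ x.2⟩) (by
      constructor
      · rintro ⟨x, hx⟩ ⟨y, hy⟩ hxy
        have : g x = g y := congrArg Subtype.val hxy
        have h1 := hg x hx
        rw [this] at h1
        exact Subtype.ext (h.inj _ _ _ h1 (hg y hy))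
      · rintro ⟨y, x, hxy⟩
        exact ⟨⟨x, y, hxy⟩, Subtype.ext (hinj x y hxy)⟩)
  refine ⟨e.extendSubtype, fun x y hxy => ?_⟩
  rw [Equiv.extendSubtype_apply_of_mem e x ⟨y, hxy⟩]
  exact hinj x y hxy

/-! ### Alternating colorings along the cycles of a permutation -/

open Equiv.Perm in
/-- Positions along a cycle, starting from `b`. -/
lemma exists_pos {V : Type*} [Finite V] (σ : Equiv.Perm V) (b : V) :
    ∃ pos : V → ℕ, ∀ x, SameCycle σ b x → (σ x ≠ b → pos (σ x) = pos x + 1) ∧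
      (σ ^ (pos x)) b = x ∧ ∀ i, (σ ^ i) b = x → pos x ≤ i := by
  classical
  refine ⟨fun x => if h : ∃ i : ℕ, (σ ^ i) b = x then Nat.find h else 0, fun x hx => ?_⟩
  have h1 : ∃ i : ℕ, (σ ^ i) b = x := by
    obtain ⟨i, _, hi⟩ := hx.exists_pow_eq'; exact ⟨i, hi⟩
  have h2 : ∃ i : ℕ, (σ ^ i) b = σ x := by
    obtain ⟨i, hi⟩ := h1; exact ⟨i + 1, by rw [pow_succ', Equiv.Perm.mul_apply, hi]⟩
  simp only [dif_pos h1, dif_pos h2]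
  refine ⟨fun hne => ?_, Nat.find_spec h1, fun i hi => Nat.find_min' h1 hi⟩
  apply le_antisymm
  · apply Nat.find_min'
    rw [pow_succ', Equiv.Perm.mul_apply, Nat.find_spec h1]
  · have hs := Nat.find_spec h2
    rcases hj : Nat.find h2 with _ | j
    · rw [hj] at hs; simp at hs; exact absurd hs.symm hne
    · rw [hj, pow_succ', Equiv.Perm.mul_apply] at hs
      have := Nat.find_min' h1 (σ.injective hs)
      omega

open Equiv.Perm in
lemma exists_alt {V : Type*} [Finite V] (σ : Equiv.Perm V) (b : V) (t : Bool) :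
    ∃ c : V → Bool, c b = t ∧ ∀ x, SameCycle σ b x → σ x ≠ b → c (σ x) = !c x := by
  obtain ⟨pos, hpos⟩ := exists_pos σ b
  have hb : pos b = 0 := by
    have := (hpos b (SameCycle.refl _ _)).2.2 0 (by simp)
    omega
  refine ⟨fun x => if pos x % 2 = 0 then t else !t, by simp [hb], fun x hx hne => ?_⟩
  have := (hpos x hx).1 hne
  simp only [this]
  rcases Nat.mod_two_eq_zero_or_one (pos x) with h | h
  · have h' : (pos x + 1) % 2 = 1 := by omega
    simp [h, h']
  · have h' : (pos x + 1) % 2 = 0 := by omega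
    simp [h', h]

open Equiv.Perm in
/-- If there is no alternating coloring of the cycle then its period is odd. -/
lemma odd_period {V : Type*} [Finite V] (σ : Equiv.Perm V) (b : V)
    (h : ¬ ∃ c : V → Bool, ∀ x, SameCycle σ b x → c (σ x) = !c x) (m : ℕ) (hm : 0 < m)
    (hm' : Even m) (hfix : (σ ^ m) b = b) (hmin : ∀ i, 0 < i → i < m → (σ ^ i) b ≠ b) : False := by
  obtain ⟨pos, hpos⟩ := exists_pos σ b
  have hb : pos b = 0 := by
    have := (hpos b (SameCycle.refl _ _)).2.2 0 (by simp)
    omega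
  apply h
  refine ⟨fun x => decide (pos x % 2 = 0), fun x hx => ?_⟩
  by_cases hne : σ x = b
  · have h1 : pos x + 1 = m := by
      have h2 : (σ ^ (pos x + 1)) b = b := by
        rw [pow_succ', Equiv.Perm.mul_apply, (hpos x hx).2.1, hne]
      have h3 : (σ ^ (m - 1)) b = x := by
        apply σ.injective
        rw [← Equiv.Perm.mul_apply, ← pow_succ', hne]
        have : m - 1 + 1 = m := by omega
        rw [this, hfix]
      have h4 := (hpos x hx).2.2 _ h3
      by_contra h5
      exact hmin _ (by omega) (by omega) h2
    rw [hne]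
    have : pos x % 2 = 1 := by rcases hm' with ⟨k, hk⟩; omega
    simp [this, hb]
  · have := (hpos x hx).1 hne
    simp only [this]
    rcases Nat.mod_two_eq_zero_or_one (pos x) with h | h
    · have h' : (pos x + 1) % 2 = 1 := by omega
      simp [h, h']
    · have h' : (pos x + 1) % 2 = 0 := by omega
      simp [h', h]

/-! ### Odd cycles and their segments -/

open Equiv.Perm

/-- `x` lies on a cycle of `σ` all of whose arcs belong to `R`, of odd length. -/
def OddC {V : Type*} (R : V → V → Prop) (σ : Equiv.Perm V) (x : V) : Prop :=
  (∀ y, SameCycle σ x y → R y (σ y)) ∧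
    ¬ ∃ c : V → Bool, ∀ y, SameCycle σ x y → c (σ y) = !c y

lemma OddC.congr {V : Type*} {R : V → V → Prop} {σ : Equiv.Perm V} {x y : V}
    (h : OddC R σ x) (hxy : SameCycle σ x y) : OddC R σ y := by
  refine ⟨fun z hz => h.1 z (hxy.trans hz), fun ⟨c, hc⟩ => h.2 ⟨c, fun z hz => ?_⟩⟩
  exact hc z (hxy.symm.trans hz)

/-- The data used in the coloring argument. -/
structure Setup {V : Type*} (G : SimpleGraph V) (μ : V → V) (R : V → V → Prop)
    (σ : Equiv.Perm V) : Prop where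
  inv : ∀ v, μ (μ v) = v
  madj : ∀ v, μ v = v ∨ G.Adj v (μ v)
  adj : ∀ x y, (G.Adj x y ∧ μ x ≠ y) ↔ (R x y ∨ R y x)
  asymm : ∀ x y, R x y → ¬ R y x
  out : ∀ x y z, R x y → R x z → y = z
  inj : ∀ x y z, R x z → R y z → x = y
  perm : ∀ x y, R x y → σ x = y
  tri : ∀ x y z, R x y → R y z → R z x → False
  noH2 : NoH2 G

/-- The segment starting at `s` has no inner chord. -/
def ChordFree {V : Type*} (μ : V → V) (σ : Equiv.Perm V) (s : V) : Prop :=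
  μ s ≠ σ (σ s) ∧ μ s ≠ σ (σ (σ s)) ∧ μ (σ s) ≠ σ (σ (σ s))

section
variable {V : Type*} {G : SimpleGraph V} {μ : V → V} {R : V → V → Prop}
  {σ : Equiv.Perm V}

lemma sc1 {x y : V} (h : SameCycle σ x y) : SameCycle σ x (σ y) := by
  simpa using h

lemma Setup.ne [Finite V] (S : Setup G μ R σ) {x : V} (hx : OddC R σ x) :
    σ x ≠ x ∧ σ (σ x) ≠ x ∧ σ (σ (σ x)) ≠ x ∧ σ (σ (σ (σ x))) ≠ x ∧
      σ (σ (σ (σ (σ (σ x))))) ≠ x := by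
  have r0 := hx.1 x (SameCycle.refl _ _)
  have r1 := hx.1 _ (sc1 (SameCycle.refl _ _))
  have r2 := hx.1 _ (sc1 (sc1 (SameCycle.refl _ _)))
  have h1 : σ x ≠ x := by
    intro h; rw [h] at r0; exact S.asymm _ _ r0 r0
  have h2 : σ (σ x) ≠ x := by
    intro h; rw [h] at r1; exact S.asymm _ _ r0 r1
  have h3 : σ (σ (σ x)) ≠ x := by
    intro h; rw [h] at r2; exact S.tri _ _ _ r0 r1 r2
  have p2 : (σ ^ 2) x = σ (σ x) := by simp [pow_succ]
  have p3 : (σ ^ 3) x = σ (σ (σ x)) := by simp [pow_succ]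
  have p4 : (σ ^ 4) x = σ (σ (σ (σ x))) := by simp [pow_succ]
  have p5 : (σ ^ 5) x = σ (σ (σ (σ (σ x)))) := by simp [pow_succ]
  have p6 : (σ ^ 6) x = σ (σ (σ (σ (σ (σ x))))) := by simp [pow_succ]
  have h4 : σ (σ (σ (σ x))) ≠ x := by
    intro h
    refine odd_period σ x hx.2 4 (by norm_num) (by decide) (by rw [p4, h]) ?_
    intro i hi hi'
    interval_cases i
    · simpa using h1
    · rwa [p2]
    · rwa [p3]
  refine ⟨h1, h2, h3, h4, ?_⟩
  intro h
  refine odd_period σ x hx.2 6 (by norm_num) (by decide) (by rw [p6, h]) ?_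
  intro i hi hi'
  interval_cases i
  · simpa using h1
  · rwa [p2]
  · rwa [p3]
  · rwa [p4]
  · rw [p5]; intro h5; rw [h5] at h; exact h1 h

lemma Setup.exists_chordFree [Finite V] (S : Setup G μ R σ) {x : V} (hx : OddC R σ x) :
    ∃ s, SameCycle σ x s ∧ ChordFree μ σ s := by
  by_contra hcon
  push Not at hcon
  have hc : ∀ s, SameCycle σ x s →
      μ s = σ (σ s) ∨ μ s = σ (σ (σ s)) ∨ μ (σ s) = σ (σ (σ s)) := by
    intro s hs
    have := hcon s hs
    unfold ChordFree at this
    tauto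
  have inv := S.inv
  by_cases hA : ∃ w, SameCycle σ x w ∧ μ w = σ (σ w)
  · obtain ⟨w, hw, hA⟩ := hA
    have ho := hx.congr hw
    obtain ⟨n1, n2, n3, n4, n6⟩ := S.ne ho
    set v2 := σ w with e2
    set v3 := σ v2 with e3
    set v4 := σ v3 with e4
    set v5 := σ v4 with e5
    set v6 := σ v5 with e6
    set v7 := σ v6 with e7
    set v8 := σ v7 with e8
    have s2 : SameCycle σ x v2 := sc1 hw
    have s3 : SameCycle σ x v3 := sc1 s2
    have s4 : SameCycle σ x v4 := sc1 s3
    have s5 : SameCycle σ x v5 := sc1 s4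
    have s6 : SameCycle σ x v6 := sc1 s5
    have c2 := hc _ s2
    have c3 := hc _ s3
    have c5 := hc _ s5
    have m2 := S.ne (hx.congr s2)
    have m4 := S.ne (hx.congr s4)
    simp only [← e3, ← e4, ← e5, ← e6, ← e7, ← e8] at c2 c3 c5 m2 m4
    have i1 : μ v3 = w := by rw [← hA, inv]
    by_cases h6 : v6 = w
    · -- length five
      have a1 := (S.adj _ _).2 (Or.inl (hx.1 _ hw))
      have a2 := (S.adj _ _).2 (Or.inl (hx.1 _ s2))
      have a3 := (S.adj _ _).2 (Or.inl (hx.1 _ s3))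
      have a4 := (S.adj _ _).2 (Or.inl (hx.1 _ s4))
      have a5 := (S.adj _ _).2 (Or.inl (hx.1 _ s5))
      simp only [← e2, ← e3, ← e4, ← e5, ← e6] at a1 a2 a3 a4 a5
      rw [h6] at a5
      have a6 : G.Adj w v3 := by
        have := S.madj w
        rw [hA] at this
        exact this.resolve_left n2
      rcases c2 with c2 | c2 | c2
      · have a7 : G.Adj v2 v4 := by
          have := S.madj v2
          rw [c2] at this
          exact this.resolve_left m2.2.1
        exact S.noH2 v2 v3 w v4 v5 a2.1 a1.1 a6 a7.symm a3.1.symm a5.1.symm a4.1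
          n3.symm m2.2.2.1 (by
            intro h
            have := S.ne (hx.congr s3)
            simp only [← e4, ← e5] at this
            exact this.2.1 h)
      · have a7 : G.Adj v2 v5 := by
          have := S.madj v2
          rw [c2] at this
          exact this.resolve_left m2.2.2.1
        exact S.noH2 w v2 v3 v5 v4 a1.1 a6.symm a2.1.symm a5.1 a7.symm a3.1 a4.1.symm
          (by
            intro h
            have := S.ne (hx.congr s3)
            simp only [← e4, ← e5] at this
            exact this.2.1 h.symm) n3 m2.2.1
      · rw [i1] at c2; exact n4 c2.symm
    · have k3 : μ v4 = v6 := by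
        rcases c3 with c3 | c3 | c3
        · rw [i1] at c3; exact absurd c3.symm n4
        · rw [i1] at c3; exact absurd c3.symm h6
        · exact c3
      have k2 : μ v2 = v5 := by
        rcases c2 with c2 | c2 | c2
        · rw [← c2, inv] at k3; exact absurd k3.symm m2.2.2.2.1
        · exact c2
        · rw [i1] at c2; exact absurd c2.symm n4
      have k5 : μ v5 = v2 := by rw [← k2, inv]
      have k6 : μ v6 = v4 := by rw [← k3, inv]
      rcases c5 with c5 | c5 | c5
      · rw [k5] at c5
        exact h6 (σ.injective c5.symm)
      · rw [k5] at c5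
        exact m2.2.2.2.2 c5.symm
      · rw [k6] at c5
        exact m4.2.2.2.1 c5.symm
  · push Not at hA
    have hB : ∀ s, SameCycle σ x s → μ s = σ (σ (σ s)) := by
      intro s hs
      rcases hc s hs with h | h | h
      · exact absurd h (hA s hs)
      · exact h
      · exact absurd h (hA _ (sc1 hs))
    have h1 := hB x (SameCycle.refl _ _)
    have h2 := hB _ (sc1 (sc1 (sc1 (SameCycle.refl σ x))))
    rw [← h1, inv, h1] at h2
    exact (S.ne hx).2.2.2.2 h2.symm

end

/-! ### Choosing segments with the fewest mismatches -/

section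
variable {V : Type*} {G : SimpleGraph V} {μ : V → V} {R : V → V → Prop} {σ : Equiv.Perm V}

/-- The cycle of a vertex. -/
abbrev CycQ {V : Type*} (σ : Equiv.Perm V) : Type _ := Quotient (SameCycle.setoid σ)

/-- The projection to the cycles. -/
def cyc {V : Type*} (σ : Equiv.Perm V) (x : V) : CycQ σ := Quotient.mk (SameCycle.setoid σ) x

lemma cyc_eq {x y : V} : cyc σ x = cyc σ y ↔ SameCycle σ x y := by
  unfold cyc
  exact Quotient.eq (r := SameCycle.setoid σ)

open Classical in
/-- The status (low = `false`, high = `true`) of a vertex for a choice of segments. -/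
noncomputable def st {V : Type*} (R : V → V → Prop) (σ : Equiv.Perm V)
    (cfg : CycQ σ → V × Bool) (v : V) : Option Bool :=
  if ¬ OddC R σ v then none
  else if v = (cfg (cyc σ v)).1 ∨ v = σ (cfg (cyc σ v)).1 then some (cfg (cyc σ v)).2
  else if v = σ (σ (cfg (cyc σ v)).1) ∨ v = σ (σ (σ (cfg (cyc σ v)).1)) then
    some (!(cfg (cyc σ v)).2)
  else none

/-- The matching edge at `v` joins a low and a high vertex. -/
def Mis {V : Type*} (μ : V → V) (R : V → V → Prop) (σ : Equiv.Perm V)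
    (cfg : CycQ σ → V × Bool) (v : V) : Prop :=
  ∃ a, st R σ cfg v = some a ∧ st R σ cfg (μ v) = some (!a)

/-- Every odd cycle has a chord-free segment. -/
def Valid {V : Type*} (μ : V → V) (R : V → V → Prop) (σ : Equiv.Perm V)
    (cfg : CycQ σ → V × Bool) : Prop :=
  ∀ x, OddC R σ x → SameCycle σ x (cfg (cyc σ x)).1 ∧ ChordFree μ σ (cfg (cyc σ x)).1

lemma Mis.symm (S : Setup G μ R σ) {cfg : CycQ σ → V × Bool} {v : V} (h : Mis μ R σ cfg v) :
    Mis μ R σ cfg (μ v) := by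
  obtain ⟨a, h1, h2⟩ := h
  exact ⟨!a, h2, by rw [S.inv, h1, Bool.not_not]⟩

lemma Mis.odd {cfg : CycQ σ → V × Bool} {v : V} (h : Mis μ R σ cfg v) : OddC R σ v := by
  obtain ⟨a, h1, h2⟩ := h
  by_contra hc
  simp [st, hc] at h1

lemma Mis.not_sameCycle (S : Setup G μ R σ) {cfg : CycQ σ → V × Bool}
    (hv : Valid μ R σ cfg) {v : V} (h : Mis μ R σ cfg v) : ¬ SameCycle σ v (μ v) := by
  have key : ∀ v, st R σ cfg v = some (cfg (cyc σ v)).2 →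
      st R σ cfg (μ v) = some (!(cfg (cyc σ v)).2) → OddC R σ v → ¬ SameCycle σ v (μ v) := by
    intro v h1 h2 ho hs
    have ho' : OddC R σ (μ v) := ho.congr hs
    have hq : cyc σ (μ v) = cyc σ v := cyc_eq.2 hs.symm
    have hc := hv v ho
    obtain ⟨c1, c2, c3⟩ := hc.2
    have r := ho.1 _ (sc1 hc.1)
    have r' := ((S.adj _ _).2 (Or.inl r)).2
    unfold st at h1 h2
    rw [hq] at h2
    generalize cfg (cyc σ v) = p at *
    obtain ⟨s, d⟩ := p
    simp only at *
    have hd : d ≠ !d := by cases d <;> decide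
    have g1 : v = s ∨ v = σ s := by
      by_contra hcon
      simp only [ho, not_true_eq_false, if_false, hcon] at h1
      split_ifs at h1
      · exact hd (Option.some.inj h1).symm
    have g2 : μ v = σ (σ s) ∨ μ v = σ (σ (σ s)) := by
      by_contra hcon
      simp only [ho', not_true_eq_false, if_false, hcon] at h2
      split_ifs at h2
      · exact hd (Option.some.inj h2)
    rcases g1 with rfl | rfl <;> rcases g2 with h | h
    · exact c1 h
    · exact c2 h
    · exact r' h
    · exact c3 h
  obtain ⟨a, h1, h2⟩ := id h
  intro hs
  have ho := h.odd
  have hq : cyc σ (μ v) = cyc σ v := cyc_eq.2 hs.symm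
  by_cases ha : a = (cfg (cyc σ v)).2
  · subst ha
    exact key v h1 h2 ho hs
  · have ha' : (!a) = (cfg (cyc σ v)).2 := by
      revert ha; cases a <;> cases (cfg (cyc σ v)).2 <;> decide
    refine key (μ v) ?_ ?_ (ho.congr hs) ?_
    · rw [hq, ← ha', h2]
    · rw [hq, ← ha', S.inv, h1, Bool.not_not]
    · rw [S.inv]; exact hs.symm

open Classical in
/-- Number of vertices at mismatched edges. -/
noncomputable def cost {V : Type*} [Fintype V] (μ : V → V) (R : V → V → Prop)
    (σ : Equiv.Perm V) (cfg : CycQ σ → V × Bool) : ℕ :=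
  (Finset.univ.filter (fun v => Mis μ R σ cfg v)).card

open Classical in
lemma cost_split [Fintype V] (S : Setup G μ R σ) {cfg : CycQ σ → V × Bool}
    (hv : Valid μ R σ cfg) (x : V) :
    cost μ R σ cfg =
      2 * (Finset.univ.filter (fun v => SameCycle σ x v ∧ Mis μ R σ cfg v)).card +
      (Finset.univ.filter (fun v => ¬ SameCycle σ x v ∧ ¬ SameCycle σ x (μ v) ∧
        Mis μ R σ cfg v)).card := by
  have h1 : (Finset.univ.filter (fun v => SameCycle σ x v ∧ Mis μ R σ cfg v)).card =
      (Finset.univ.filter (fun v => SameCycle σ x (μ v) ∧ Mis μ R σ cfg v)).card := by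
    apply Finset.card_bij' (fun v _ => μ v) (fun v _ => μ v)
    · intro v hv
      simp only [Finset.mem_filter, Finset.mem_univ, true_and] at hv ⊢
      rw [S.inv]; exact ⟨hv.1, hv.2.symm S⟩
    · intro v hv
      simp only [Finset.mem_filter, Finset.mem_univ, true_and] at hv ⊢
      exact ⟨hv.1, hv.2.symm S⟩
    · intro v _; exact S.inv v
    · intro v _; exact S.inv v
  have h2 : Finset.univ.filter (fun v => Mis μ R σ cfg v) =
      (Finset.univ.filter (fun v => SameCycle σ x v ∧ Mis μ R σ cfg v) ∪
      Finset.univ.filter (fun v => SameCycle σ x (μ v) ∧ Mis μ R σ cfg v)) ∪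
      Finset.univ.filter (fun v => ¬ SameCycle σ x v ∧ ¬ SameCycle σ x (μ v) ∧
        Mis μ R σ cfg v) := by
    ext v
    simp only [Finset.mem_filter, Finset.mem_univ, true_and, Finset.mem_union]
    tauto
  unfold cost
  rw [h2, Finset.card_union_of_disjoint, Finset.card_union_of_disjoint, ← h1]
  · ring
  · rw [Finset.disjoint_left]
    intro v ha hb
    simp only [Finset.mem_filter, Finset.mem_univ, true_and] at ha hb
    exact ha.2.not_sameCycle S hv (ha.1.symm.trans hb.1)
  · rw [Finset.disjoint_left]
    intro v ha hb
    simp only [Finset.mem_filter, Finset.mem_univ, true_and, Finset.mem_union] at ha hb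
    tauto

/-- Local number of mismatches of a segment. -/
def wt (d : Bool) (t0 t1 t2 t3 : Option Bool) : ℕ :=
  (if t0 = some (!d) then 1 else 0) + ((if t1 = some (!d) then 1 else 0) +
    ((if t2 = some d then 1 else 0) + (if t3 = some d then 1 else 0)))

lemma wt1 : ∀ (d : Bool) (t0 t1 t2 t3 : Option Bool), wt d t0 t1 t2 t3 ≤ wt (!d) t0 t1 t2 t3 →
    (t0 = some (!d) ∨ t1 = some (!d)) → (t2 = some d ∨ t3 = some d) →
    wt d t0 t1 t2 t3 = 2 ∧ (t0 ≠ none ∧ t1 ≠ none ∧ t2 ≠ none ∧ t3 ≠ none ∧ t0 ≠ t1 ∧ t2 ≠ t3) := by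
  intro d t0 t1 t2 t3
  rcases d with _ | _ <;> rcases t0 with _ | (_ | _) <;> rcases t1 with _ | (_ | _) <;>
    rcases t2 with _ | (_ | _) <;> rcases t3 with _ | (_ | _) <;> simp [wt]

lemma wt2 : ∀ (t0 t1 t2 t3 t4 : Option Bool), t0 ≠ none → t1 ≠ none → t2 ≠ none → t3 ≠ none →
    t0 ≠ t1 → t2 ≠ t3 → 2 ≤ wt false t1 t2 t3 t4 → 2 ≤ wt true t1 t2 t3 t4 →
    t1 ≠ t2 ∧ t4 ≠ none ∧ t3 ≠ t4 := by
  decide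

/-- The status of the other end of the matching edge, if it is outside the cycle of `x`. -/
noncomputable def ext {V : Type*} (μ : V → V) (R : V → V → Prop) (σ : Equiv.Perm V)
    (cfg : CycQ σ → V × Bool) (x v : V) : Option Bool :=
  open Classical in if SameCycle σ x (μ v) then none else st R σ cfg (μ v)

open Classical in
/-- The result of replacing the segment in the cycle of `x`. -/
noncomputable def upd {V : Type*} (σ : Equiv.Perm V) (cfg : CycQ σ → V × Bool) (x s : V)
    (d : Bool) : CycQ σ → V × Bool :=
  Function.update cfg (cyc σ x) (s, d)

open Classical in
lemma upd_same {cfg : CycQ σ → V × Bool} {x s v : V} {d : Bool} (h : SameCycle σ x v) :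
    upd σ cfg x s d (cyc σ v) = (s, d) := by
  unfold upd
  rw [← cyc_eq.2 h, Function.update_self]

open Classical in
lemma upd_other {cfg : CycQ σ → V × Bool} {x s v : V} {d : Bool} (h : ¬ SameCycle σ x v) :
    upd σ cfg x s d (cyc σ v) = cfg (cyc σ v) := by
  unfold upd
  rw [Function.update_of_ne]
  intro h'; exact h (cyc_eq.1 h'.symm)

lemma st_upd_other {cfg : CycQ σ → V × Bool} {x s v : V} {d : Bool} (h : ¬ SameCycle σ x v) :
    st R σ (upd σ cfg x s d) v = st R σ cfg v := by
  unfold st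
  rw [upd_other h]

lemma valid_upd {cfg : CycQ σ → V × Bool} (hv : Valid μ R σ cfg) {x s : V} {d : Bool}
    (hs : SameCycle σ x s) (hc : ChordFree μ σ s) : Valid μ R σ (upd σ cfg x s d) := by
  intro y hy
  by_cases h : SameCycle σ x y
  · rw [upd_same h]; exact ⟨h.symm.trans hs, hc⟩
  · rw [upd_other h]; exact hv y hy

/-- Statuses on a segment. -/
lemma Setup.st_seg [Finite V] (S : Setup G μ R σ) {cfg : CycQ σ → V × Bool} {x s : V} {d : Bool}
    (hx : OddC R σ x) (hs : SameCycle σ x s) (hcfg : cfg (cyc σ x) = (s, d)) :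
    st R σ cfg s = some d ∧ st R σ cfg (σ s) = some d ∧ st R σ cfg (σ (σ s)) = some (!d) ∧
      st R σ cfg (σ (σ (σ s))) = some (!d) ∧
      ∀ v, SameCycle σ x v → v ≠ s → v ≠ σ s → v ≠ σ (σ s) → v ≠ σ (σ (σ s)) →
        st R σ cfg v = none := by
  have e : ∀ v, SameCycle σ x v → cfg (cyc σ v) = (s, d) := by
    intro v hv; rw [← cyc_eq.2 hv, hcfg]
  have o : ∀ v, SameCycle σ x v → OddC R σ v := fun v hv => hx.congr hv
  obtain ⟨n1, n2, n3, n4, n6⟩ := S.ne (o s hs)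
  obtain ⟨m1, m2, m3, m4, m6⟩ := S.ne (o _ (sc1 hs))
  refine ⟨?_, ?_, ?_, ?_, ?_⟩
  · unfold st; rw [e s hs]; simp [o s hs]
  · unfold st; rw [e _ (sc1 hs)]; simp [o _ (sc1 hs)]
  · unfold st; rw [e _ (sc1 (sc1 hs))]; simp only [o _ (sc1 (sc1 hs))]; simp [n2, m1]
  · unfold st; rw [e _ (sc1 (sc1 (sc1 hs)))]; simp only [o _ (sc1 (sc1 (sc1 hs)))]; simp [n3, m2]
  · intro v hv h1 h2 h3 h4
    unfold st; rw [e v hv]; simp [o v hv, h1, h2, h3, h4]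

open Classical in
lemma Setup.card_seg [Fintype V] (S : Setup G μ R σ) {cfg : CycQ σ → V × Bool}
    (hv : Valid μ R σ cfg) {x s : V} {d : Bool}
    (hx : OddC R σ x) (hs : SameCycle σ x s) (hcfg : cfg (cyc σ x) = (s, d)) :
    (Finset.univ.filter (fun v => SameCycle σ x v ∧ Mis μ R σ cfg v)).card =
      wt d (ext μ R σ cfg x s) (ext μ R σ cfg x (σ s)) (ext μ R σ cfg x (σ (σ s)))
        (ext μ R σ cfg x (σ (σ (σ s)))) := by
  obtain ⟨t0, t1, t2, t3, t4⟩ := S.st_seg hx hs hcfg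
  have mis : ∀ v a, SameCycle σ x v → st R σ cfg v = some a →
      (Mis μ R σ cfg v ↔ ext μ R σ cfg x v = some (!a)) := by
    intro v a hxv ha
    constructor
    · intro h
      have := h.not_sameCycle S hv
      obtain ⟨a', h1, h2⟩ := h
      rw [ha] at h1
      obtain rfl := Option.some.inj h1
      unfold ext
      rw [if_neg (fun h => this (hxv.symm.trans h)), h2]
    · intro h
      unfold ext at h
      split_ifs at h
      exact ⟨a, ha, h⟩
  have s1 := sc1 hs
  have s2 := sc1 s1
  have s3 := sc1 s2
  obtain ⟨n1, n2, n3, n4, n6⟩ := S.ne (hx.congr hs)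
  have hset : Finset.univ.filter (fun v => SameCycle σ x v ∧ Mis μ R σ cfg v) =
      ({s, σ s, σ (σ s), σ (σ (σ s))} : Finset V).filter (fun v => Mis μ R σ cfg v) := by
    ext v
    simp only [Finset.mem_filter, Finset.mem_univ, true_and, Finset.mem_insert,
      Finset.mem_singleton]
    constructor
    · rintro ⟨h1, h2⟩
      refine ⟨?_, h2⟩
      by_contra hcon
      push Not at hcon
      have := t4 v h1 hcon.1 hcon.2.1 hcon.2.2.1 hcon.2.2.2
      obtain ⟨a, h3, _⟩ := h2
      rw [this] at h3
      exact absurd h3 (by simp)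
    · rintro ⟨h1, h2⟩
      refine ⟨?_, h2⟩
      rcases h1 with rfl | rfl | rfl | rfl <;> assumption
  have d1 : s ∉ ({σ s, σ (σ s), σ (σ (σ s))} : Finset V) := by
    simp [n1.symm, n2.symm, n3.symm]
  have d2 : σ s ∉ ({σ (σ s), σ (σ (σ s))} : Finset V) := by
    simp [n1.symm, n2.symm]
  have d3 : σ (σ s) ∉ ({σ (σ (σ s))} : Finset V) := by
    simp [n1.symm]
  rw [hset, Finset.card_filter, Finset.sum_insert d1, Finset.sum_insert d2, Finset.sum_insert d3,
    Finset.sum_singleton]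
  simp only [mis _ _ hs t0, mis _ _ s1 t1, mis _ _ s2 t2, mis _ _ s3 t3, Bool.not_not]
  rfl

lemma Setup.exists_cfg [Finite V] (S : Setup G μ R σ) :
    ∃ cfg : CycQ σ → V × Bool, Valid μ R σ cfg ∧
      ∀ x, OddC R σ x → ∀ s d, cfg (cyc σ x) = (s, d) →
        ¬ ((Mis μ R σ cfg s ∨ Mis μ R σ cfg (σ s)) ∧
          (Mis μ R σ cfg (σ (σ s)) ∨ Mis μ R σ cfg (σ (σ (σ s))))) := by
  classical
  cases nonempty_fintype V
  -- there is a valid configuration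
  have hex : ∃ cfg : CycQ σ → V × Bool, Valid μ R σ cfg := by
    have : ∀ q : CycQ σ, ∃ p : V × Bool, OddC R σ q.out →
        SameCycle σ q.out p.1 ∧ ChordFree μ σ p.1 := by
      intro q
      by_cases h : OddC R σ q.out
      · obtain ⟨s, h1, h2⟩ := S.exists_chordFree h
        exact ⟨(s, false), fun _ => ⟨h1, h2⟩⟩
      · exact ⟨(q.out, false), fun h' => absurd h' h⟩
    choose cfg hcfg using this
    refine ⟨cfg, fun x hx => ?_⟩
    have hq : SameCycle σ x (cyc σ x).out := by
      rw [← cyc_eq]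
      unfold cyc
      exact (Quotient.out_eq _).symm
    have := hcfg (cyc σ x) (hx.congr hq)
    exact ⟨hq.trans this.1, this.2⟩
  obtain ⟨cfg, hv, hmin⟩ : ∃ cfg : CycQ σ → V × Bool, Valid μ R σ cfg ∧
      ∀ cfg', Valid μ R σ cfg' → cost μ R σ cfg ≤ cost μ R σ cfg' := by
    have hP : ∃ n, ∃ cfg, Valid μ R σ cfg ∧ cost μ R σ cfg = n := by
      obtain ⟨cfg, h⟩ := hex
      exact ⟨_, cfg, h, rfl⟩
    obtain ⟨cfg, h1, h2⟩ := Nat.find_spec hP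
    refine ⟨cfg, h1, fun cfg' h' => ?_⟩
    rw [h2]
    exact Nat.find_min' hP ⟨cfg', h', rfl⟩
  refine ⟨cfg, hv, fun x hx s d hcfg hbad => ?_⟩
  set τ := ext μ R σ cfg x with hτ
  have hs : SameCycle σ x s := by have := (hv x hx).1; rwa [hcfg] at this
  have hle : ∀ s' d', SameCycle σ x s' → ChordFree μ σ s' →
      wt d (τ s) (τ (σ s)) (τ (σ (σ s))) (τ (σ (σ (σ s)))) ≤
      wt d' (τ s') (τ (σ s')) (τ (σ (σ s'))) (τ (σ (σ (σ s')))) := by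
    intro s' d' hs' hc'
    have hv' := valid_upd hv (d := d') hs' hc'
    have h1 := hmin _ hv'
    rw [cost_split S hv x, cost_split S hv' x, S.card_seg hv hx hs hcfg,
      S.card_seg hv' hx hs' (upd_same (SameCycle.refl _ _))] at h1
    have h2 : ∀ v, ext μ R σ (upd σ cfg x s' d') x v = τ v := by
      intro v
      rw [hτ]
      unfold ext
      split_ifs with h
      · rfl
      · exact st_upd_other h
    have h3 : (Finset.univ.filter (fun v => ¬ SameCycle σ x v ∧ ¬ SameCycle σ x (μ v) ∧
        Mis μ R σ (upd σ cfg x s' d') v)) =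
        (Finset.univ.filter (fun v => ¬ SameCycle σ x v ∧ ¬ SameCycle σ x (μ v) ∧
        Mis μ R σ cfg v)) := by
      apply Finset.filter_congr
      intro v _
      refine and_congr_right fun ha => and_congr_right fun hb => ?_
      unfold Mis
      rw [st_upd_other ha, st_upd_other hb]
    rw [h3] at h1
    simp only [h2] at h1
    simp only [← hτ] at h1
    omega
  obtain ⟨t0, t1, t2, t3, -⟩ := S.st_seg hx hs hcfg
  have mis : ∀ v a, SameCycle σ x v → st R σ cfg v = some a →
      Mis μ R σ cfg v → τ v = some (!a) := by
    intro v a hxv ha h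
    have := h.not_sameCycle S hv
    obtain ⟨a', h1, h2⟩ := h
    rw [ha] at h1
    obtain rfl := Option.some.inj h1
    rw [hτ]
    unfold ext
    rw [if_neg (fun h => this (hxv.symm.trans h)), h2]
  have s1 := sc1 hs
  have s2 := sc1 s1
  have s3 := sc1 s2
  have hcs : ChordFree μ σ s := by have := (hv x hx).2; rwa [hcfg] at this
  have hb1 : τ s = some (!d) ∨ τ (σ s) = some (!d) :=
    hbad.1.imp (mis _ _ hs t0) (mis _ _ s1 t1)
  have hb2 : τ (σ (σ s)) = some d ∨ τ (σ (σ (σ s))) = some d := by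
    have := hbad.2.imp (mis _ _ s2 t2) (mis _ _ s3 t3)
    simpa using this
  obtain ⟨hw, a0, a1, a2, a3, a01, a23⟩ := wt1 d _ _ _ _ (hle s (!d) hs hcs) hb1 hb2
  have nonchord : ∀ v, τ v ≠ none → ¬ SameCycle σ x (μ v) := by
    intro v hv h
    apply hv
    rw [hτ]; unfold ext; rw [if_pos h]
  have step : ∀ u, SameCycle σ x u → τ u ≠ none → τ (σ u) ≠ none → τ (σ (σ u)) ≠ none →
      τ (σ (σ (σ u))) ≠ none → τ u ≠ τ (σ u) → τ (σ (σ u)) ≠ τ (σ (σ (σ u))) →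
      τ (σ u) ≠ τ (σ (σ u)) ∧ τ (σ (σ (σ (σ u)))) ≠ none ∧
        τ (σ (σ (σ u))) ≠ τ (σ (σ (σ (σ u)))) := by
    intro u hu b0 b1 b2 b3 b01 b23
    have hcf : ChordFree μ σ (σ u) := by
      refine ⟨fun h => nonchord _ b1 ?_, fun h => nonchord _ b1 ?_, fun h => nonchord _ b2 ?_⟩
      · rw [h]; exact sc1 (sc1 (sc1 hu))
      · rw [h]; exact sc1 (sc1 (sc1 (sc1 hu)))
      · rw [h]; exact sc1 (sc1 (sc1 (sc1 hu)))
    refine wt2 _ _ _ _ _ b0 b1 b2 b3 b01 b23 ?_ ?_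
    · rw [← hw]; exact hle _ _ (sc1 hu) hcf
    · rw [← hw]; exact hle _ _ (sc1 hu) hcf
  have all : ∀ i : ℕ, τ ((σ ^ i) s) ≠ none ∧ τ (σ ((σ ^ i) s)) ≠ none ∧
      τ (σ (σ ((σ ^ i) s))) ≠ none ∧ τ (σ (σ (σ ((σ ^ i) s)))) ≠ none ∧
      τ ((σ ^ i) s) ≠ τ (σ ((σ ^ i) s)) ∧ τ (σ ((σ ^ i) s)) ≠ τ (σ (σ ((σ ^ i) s))) ∧
      τ (σ (σ ((σ ^ i) s))) ≠ τ (σ (σ (σ ((σ ^ i) s)))) := by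
    intro i
    induction i with
    | zero =>
      have := step s hs a0 a1 a2 a3 a01 a23
      exact ⟨a0, a1, a2, a3, a01, this.1, a23⟩
    | succ i ih =>
      obtain ⟨b0, b1, b2, b3, b01, b12, b23⟩ := ih
      have hsi : SameCycle σ x ((σ ^ i) s) := by
        simpa using hs
      have := step _ hsi b0 b1 b2 b3 b01 b23
      rw [pow_succ', Equiv.Perm.mul_apply]
      exact ⟨b1, b2, b3, this.2.1, b12, b23, this.2.2⟩
  refine hx.2 ⟨fun v => (τ v).getD false, fun y hy => ?_⟩
  obtain ⟨i, _, hi⟩ := (hs.symm.trans hy).exists_pow_eq'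
  have := all i
  rw [hi] at this
  obtain ⟨b0, b1, -, -, b01, -, -⟩ := this
  show (τ (σ y)).getD false = !(τ y).getD false
  revert b0 b1 b01
  generalize τ y = p
  generalize τ (σ y) = r
  revert p r
  decide

end

/-! ### The coloring -/

section
variable {V : Type*} {G : SimpleGraph V} {μ : V → V} {R : V → V → Prop} {σ : Equiv.Perm V}

/-- The color of a matching edge from the statuses of its ends. -/
def gg (a b : Option Bool) : ℕ :=
  if a = some false ∨ b = some false then (if a = some true ∨ b = some true then 1 else 0)
  else if a = some true ∨ b = some true then 2 else 1

lemma gg_comm (a b : Option Bool) : gg a b = gg b a := by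
  unfold gg; simp only [or_comm]

lemma gg_le (a b : Option Bool) : gg a b ≤ 2 := by
  unfold gg; split_ifs <;> omega

lemma gg_low (b : Option Bool) : gg (some false) b ≤ 1 ∧ (b ≠ some true → gg (some false) b = 0) := by
  rcases b with _ | (_ | _) <;> simp [gg]

lemma gg_high (b : Option Bool) :
    1 ≤ gg (some true) b ∧ (b ≠ some false → gg (some true) b = 2) := by
  rcases b with _ | (_ | _) <;> simp [gg]

/-- Requirement on the colors of the arcs of the cycle of `x`. -/
def ColOn {V : Type*} (R : V → V → Prop) (σ : Equiv.Perm V) (lam : V → ℕ) (x : V)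
    (col : V → ℕ) : Prop :=
  ∀ y, SameCycle σ x y → R y (σ y) →
    (lam y + 3 ≤ col y ∧ col y ≤ lam y + 8) ∧
    (lam (σ y) + 3 ≤ col y ∧ col y ≤ lam (σ y) + 8) ∧
    (R (σ y) (σ (σ y)) → Sep (col y) (col (σ y)))

lemma colOn_alt {lam : V → ℕ} (hl : ∀ v, lam v ≤ 2) (x : V) (c : V → Bool)
    (hc : ∀ y, SameCycle σ x y → R y (σ y) → R (σ y) (σ (σ y)) → c (σ y) = !c y) :
    ColOn R σ lam x (fun y => if c y then 8 else 5) := by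
  intro y hy hr
  have h1 := hl y
  have h2 := hl (σ y)
  refine ⟨?_, ?_, fun hr' => ?_⟩
  · simp only; split_ifs <;> omega
  · simp only; split_ifs <;> omega
  · have := hc y hy hr hr'
    simp only [this]
    unfold Sep
    cases c y <;> simp

lemma colOn_odd [Finite V] (S : Setup G μ R σ) {lam : V → ℕ} (hl : ∀ v, lam v ≤ 2) (x : V)
    (hx : OddC R σ x) (s : V) (hs : SameCycle σ x s) (d : Bool)
    (hlow : d = false → ∃ M, M ≤ 1 ∧ lam s ≤ M ∧ lam (σ s) ≤ M ∧ M < lam (σ (σ s)) ∧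
      M < lam (σ (σ (σ s))))
    (hhigh : d = true → ∃ M, M ≤ 1 ∧ M < lam s ∧ M < lam (σ s) ∧ lam (σ (σ s)) ≤ M ∧
      lam (σ (σ (σ s))) ≤ M) :
    ∃ col, ColOn R σ lam x col := by
  classical
  obtain ⟨c, hcb, hc⟩ := exists_alt σ (σ (σ s)) (!d)
  have s2 : SameCycle σ x (σ (σ s)) := sc1 (sc1 hs)
  have hc' : ∀ y, SameCycle σ x y → σ y ≠ σ (σ s) → c (σ y) = !c y :=
    fun y hy => hc y (s2.symm.trans hy)
  obtain ⟨n1, n2, n3, n4, n6⟩ := S.ne (hx.congr hs)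
  have hc1 : c (σ s) = !d := by
    by_contra hcon
    refine hx.2 ⟨c, fun y hy => ?_⟩
    by_cases h : σ y = σ (σ s)
    · have : y = σ s := σ.injective h
      subst this
      rw [hcb]
      revert hcon; cases c (σ s) <;> cases d <;> decide
    · exact hc' y hy h
  have hc0 : c s = d := by
    have := hc' s hs (fun h => n1 (σ.injective h).symm)
    rw [hc1] at this
    revert this; cases c s <;> cases d <;> decide
  have hc3 : c (σ (σ (σ s))) = d := by
    have := hc' (σ (σ s)) s2 (fun h => n1 (σ.injective (σ.injective h)))
    rw [hcb] at this
    rw [this]; simp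
  have hcp : ∀ y, SameCycle σ x y → σ y = s → c y = !d := by
    intro y hy h
    have := hc' y hy (fun h' => n2 (by rw [← h', h]))
    rw [h, hc0] at this
    revert this; cases c y <;> cases d <;> decide
  have key : ∀ (M A B C : ℕ), (A = M + 3 ∧ C = M + 9 ∧ d = false ∨ A = M + 9 ∧ C = M + 3 ∧ d = true) →
      B = M + 6 → M ≤ 1 →
      (lam s + 3 ≤ A ∧ A ≤ lam s + 8) → (lam (σ s) + 3 ≤ A ∧ A ≤ lam (σ s) + 8) →
      (lam (σ (σ s)) + 3 ≤ C ∧ C ≤ lam (σ (σ s)) + 8) →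
      (lam (σ (σ (σ s))) + 3 ≤ C ∧ C ≤ lam (σ (σ (σ s))) + 8) → 
      ∃ col, ColOn R σ lam x col := by
    intro M A B C hAC hB hM h0 h1 h2 h3
    refine ⟨fun y => if y = s then A else if y = σ s then B else if y = σ (σ s) then C else
      if c y then 8 else 5, ?_⟩
    intro y hy hr
    have l0 := hl y
    have l1 := hl (σ y)
    have b1 := hl (σ s)
    have b2 := hl (σ (σ s))
    by_cases y0 : y = s
    · subst y0
      refine ⟨by simpa using h0, by simpa using h1, fun _ => ?_⟩
      simp only [n1, if_true, if_false]
      unfold Sep; omega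
    by_cases y1 : y = σ s
    · subst y1
      refine ⟨?_, ?_, fun _ => ?_⟩
      · simp only [n1, if_true, if_false]; omega
      · simp only [n1, if_true, if_false]; omega
      · simp only [n1, n2, if_true, if_false, EmbeddingLike.apply_eq_iff_eq]
        unfold Sep; omega
    by_cases y2 : y = σ (σ s)
    · subst y2
      refine ⟨?_, ?_, fun _ => ?_⟩
      · simp only [n1, n2, if_true, if_false, EmbeddingLike.apply_eq_iff_eq]; omega
      · simp only [n1, n2, if_true, if_false, EmbeddingLike.apply_eq_iff_eq]; omega
      · simp only [n1, n2, n3, if_true, if_false, EmbeddingLike.apply_eq_iff_eq, hc3]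
        unfold Sep
        rcases hAC with ⟨_, _, rfl⟩ | ⟨_, _, rfl⟩ <;> simp <;> omega
    · simp only [y0, y1, y2, if_false]
      refine ⟨by split_ifs <;> omega, by split_ifs <;> omega, fun _ => ?_⟩
      by_cases ys : σ y = s
      · simp only [ys, if_true, hcp y hy ys]
        unfold Sep
        rcases hAC with ⟨_, _, rfl⟩ | ⟨_, _, rfl⟩ <;> simp <;> omega
      · have e1 : σ y ≠ σ s := fun h => y0 (σ.injective h)
        have e2 : σ y ≠ σ (σ s) := fun h => y1 (σ.injective h)
        simp only [ys, e1, e2, if_false, hc' y hy e2]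
        unfold Sep
        cases c y <;> simp
  have l0 := hl s
  have l1 := hl (σ s)
  have l2 := hl (σ (σ s))
  have l3 := hl (σ (σ (σ s)))
  cases hd : d
  · obtain ⟨M, m0, m1, m2, m3, m4⟩ := hlow hd
    exact key M (M + 3) (M + 6) (M + 9) (Or.inl ⟨rfl, rfl, hd⟩) rfl m0 (by omega) (by omega)
      (by omega) (by omega)
  · obtain ⟨M, m0, m1, m2, m3, m4⟩ := hhigh hd
    exact key M (M + 9) (M + 6) (M + 3) (Or.inr ⟨rfl, rfl, hd⟩) rfl m0 (by omega) (by omega)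
      (by omega) (by omega)

lemma Setup.exists_col [Finite V] (S : Setup G μ R σ) :
    ∃ lam col : V → ℕ, (∀ v, lam v ≤ 2) ∧ (∀ v, lam (μ v) = lam v) ∧
      ∀ x, ColOn R σ lam x col := by
  classical
  obtain ⟨cfg, hv, hcfg⟩ := S.exists_cfg
  let lam : V → ℕ := fun v => gg (st R σ cfg v) (st R σ cfg (μ v))
  have hl : ∀ v, lam v ≤ 2 := fun v => gg_le _ _
  have hsym : ∀ v, lam (μ v) = lam v := by
    intro v
    show gg _ _ = gg _ _
    rw [S.inv, gg_comm]
  have low : ∀ v, st R σ cfg v = some false → lam v ≤ 1 ∧ (¬ Mis μ R σ cfg v → lam v = 0) := by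
    intro v h
    have := gg_low (st R σ cfg (μ v))
    show gg _ _ ≤ 1 ∧ (_ → gg _ _ = 0)
    rw [h]
    exact ⟨this.1, fun hm => this.2 fun h' => hm ⟨false, h, h'⟩⟩
  have high : ∀ v, st R σ cfg v = some true → 1 ≤ lam v ∧ (¬ Mis μ R σ cfg v → lam v = 2) := by
    intro v h
    have := gg_high (st R σ cfg (μ v))
    show 1 ≤ gg _ _ ∧ (_ → gg _ _ = 2)
    rw [h]
    exact ⟨this.1, fun hm => this.2 fun h' => hm ⟨true, h, h'⟩⟩
  have each : ∀ x, ∃ col, ColOn R σ lam x col := by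
    intro x
    by_cases hx : OddC R σ x
    · rcases hp : cfg (cyc σ x) with ⟨s, d⟩
      have hs : SameCycle σ x s := by have := (hv x hx).1; rwa [hp] at this
      obtain ⟨t0, t1, t2, t3, -⟩ := S.st_seg hx hs hp
      have hm := hcfg x hx s d hp
      refine colOn_odd S hl x hx s hs d ?_ ?_
      · rintro rfl
        have a0 := low _ t0
        have a1 := low _ t1
        have a2 := high _ t2
        have a3 := high _ t3
        by_cases hP : Mis μ R σ cfg s ∨ Mis μ R σ cfg (σ s)
        · have hQ := not_or.1 fun h => hm ⟨hP, h⟩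
          have := a2.2 hQ.1
          have := a3.2 hQ.2
          exact ⟨1, by omega, by omega, by omega, by omega, by omega⟩
        · push Not at hP
          have := a0.2 hP.1
          have := a1.2 hP.2
          exact ⟨0, by omega, by omega, by omega, by omega, by omega⟩
      · rintro rfl
        have a0 := high _ t0
        have a1 := high _ t1
        have a2 := low _ t2
        have a3 := low _ t3
        by_cases hP : Mis μ R σ cfg s ∨ Mis μ R σ cfg (σ s)
        · have hQ := not_or.1 fun h => hm ⟨hP, h⟩
          have := a2.2 hQ.1
          have := a3.2 hQ.2
          exact ⟨0, by omega, by omega, by omega, by omega, by omega⟩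
        · push Not at hP
          have := a0.2 hP.1
          have := a1.2 hP.2
          exact ⟨1, by omega, by omega, by omega, by omega, by omega⟩
    · by_cases hf : ∀ y, SameCycle σ x y → R y (σ y)
      · have : ∃ c : V → Bool, ∀ y, SameCycle σ x y → c (σ y) = !c y := by
          by_contra hcon; exact hx ⟨hf, hcon⟩
        obtain ⟨c, hc⟩ := this
        exact ⟨_, colOn_alt hl x c fun y hy _ _ => hc y hy⟩
      · push Not at hf
        obtain ⟨y0, hy0, hr0⟩ := hf
        obtain ⟨c, -, hc⟩ := exists_alt σ (σ y0) false
        refine ⟨_, colOn_alt hl x c fun y hy hr _ => hc y ((sc1 hy0).symm.trans hy) ?_⟩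
        intro h
        rw [σ.injective h] at hr
        exact hr0 hr
  choose col hcol using each
  refine ⟨lam, fun y => col (cyc σ y).out y, hl, hsym, ?_⟩
  intro x y hy hr
  have e : cyc σ (σ y) = cyc σ y := (cyc_eq.2 (sc1 (SameCycle.refl _ _))).symm
  have hq : SameCycle σ (cyc σ y).out y := by
    rw [← cyc_eq]
    unfold cyc
    exact Quotient.out_eq _
  have := hcol _ y hq hr
  simp only [e]
  exact this

lemma Setup.good [Finite V] (S : Setup G μ R σ) : Good G := by
  classical
  obtain ⟨lam, col, hl, hsym, hcol⟩ := S.exists_col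
  have H : ∀ x y, R x y → (lam x + 3 ≤ col x ∧ col x ≤ lam x + 8) ∧
      (lam y + 3 ≤ col x ∧ col x ≤ lam y + 8) ∧ ∀ z, R y z → Sep (col x) (col y) := by
    intro x y hxy
    have e := S.perm _ _ hxy
    subst e
    have := hcol x x (SameCycle.refl _ _) hxy
    refine ⟨this.1, this.2.1, fun z hz => ?_⟩
    have e := S.perm _ _ hz
    subst e
    exact this.2.2 hz
  let f0 : V → V → ℕ := fun x y => if μ x = y then lam x else if R x y then col x else
    if R y x then col y else 0
  have hf0 : ∀ x y, f0 x y = f0 y x := by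
    intro x y
    show (if _ then _ else _) = (if _ then _ else _)
    by_cases h : μ x = y
    · subst h
      simp [S.inv, hsym]
    · have h' : μ y ≠ x := fun h' => h (by rw [← h', S.inv])
      simp only [h, h', if_false]
      by_cases h1 : R x y
      · simp [h1, S.asymm _ _ h1]
      · simp [h1]
  let f : Sym2 V → ℕ := Sym2.lift ⟨f0, hf0⟩
  have fm : ∀ x y, μ x = y → f s(x, y) = lam x := by
    intro x y h
    show f0 x y = _
    simp [f0, h]
  have ff : ∀ x y, R x y → f s(x, y) = col x := by
    intro x y h
    have := ((S.adj x y).2 (Or.inl h)).2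
    show f0 x y = _
    simp [f0, this, h]
  have fb : ∀ x y, R y x → f s(x, y) = col y := by
    intro x y h
    rw [Sym2.eq_swap, ff y x h]
  have sy : ∀ a b, Sep a b → Sep b a := fun a b h => h.symm
  refine ⟨f, ?_, ?_⟩
  · intro e
    induction e using Sym2.ind with
    | _ x y =>
      show f0 x y < 11
      simp only [f0]
      have := hl x
      have := hl y
      split_ifs with h1 h2 h3
      · omega
      · have := (H _ _ h2).1; omega
      · have := (H _ _ h3).1; omega
      · omega
  · have main : ∀ x y z, μ x = y → (R x z ∨ R z x) → Sep (f s(x, y)) (f s(x, z)) := by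
      intro x y z hy hz
      rw [fm x y hy]
      rcases hz with hz | hz
      · rw [ff x z hz]
        exact Or.inl (H _ _ hz).1
      · rw [fb x z hz]
        exact Or.inl (H _ _ hz).2.1
    intro x y z hxy hxz hyz
    by_cases hy : μ x = y
    · have hz : μ x ≠ z := fun h => hyz (hy.symm.trans h)
      exact main x y z hy ((S.adj x z).1 ⟨hxz, hz⟩)
    · by_cases hz : μ x = z
      · exact sy _ _ (main x z y hz ((S.adj x y).1 ⟨hxy, hy⟩))
      · rcases (S.adj x y).1 ⟨hxy, hy⟩ with h1 | h1 <;>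
          rcases (S.adj x z).1 ⟨hxz, hz⟩ with h2 | h2
        · exact absurd (S.out _ _ _ h1 h2) hyz
        · rw [ff x y h1, fb x z h2]
          exact sy _ _ ((H _ _ h2).2.2 _ h1)
        · rw [fb x y h1, ff x z h2]
          exact (H _ _ h1).2.2 _ h2
        · exact absurd (S.inj _ _ _ h1 h2) hyz

end

/-! ### A matching covering all vertices of degree three -/

section
variable {W : Type*}

open Classical in
/-- Neighbours as a finset. -/
noncomputable def nb [Fintype W] (G : SimpleGraph W) (v : W) : Finset W :=
  Finset.univ.filter (fun w => G.Adj v w)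

lemma mem_nb [Fintype W] {G : SimpleGraph W} {v w : W} : w ∈ nb G v ↔ G.Adj v w := by
  simp [nb]

lemma nb_card_le [Fintype W] {G : SimpleGraph W} (hG : Subcubic G) (v : W) :
    (nb G v).card ≤ 3 := by
  classical
  by_contra hcon
  obtain ⟨x, hx, y, hy, z, hz, hxy, hxz, hyz⟩ := Finset.two_lt_card.1 (by omega : 2 < (nb G v).card)
  rw [mem_nb] at hx hy hz
  have : nb G v ⊆ {x, y, z} := by
    intro w hw
    rw [mem_nb] at hw
    have := hG v x y z w hx hy hz hw
    simp only [Finset.mem_insert, Finset.mem_singleton]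
    rcases this with h | h | h | h | h | h
    · exact absurd h hxy
    · exact absurd h hxz
    · exact Or.inl h.symm
    · exact absurd h hyz
    · exact Or.inr (Or.inl h.symm)
    · exact Or.inr (Or.inr h.symm)
  have := Finset.card_le_card this
  have := Finset.card_le_three (a := x) (b := y) (c := z)
  omega

lemma nb_card_eq [Fintype W] {G : SimpleGraph W} (hG : Subcubic G) {v : W} (hv : Has3 G v) :
    (nb G v).card = 3 := by
  obtain ⟨x, y, z, hx, hy, hz, hxy, hxz, hyz⟩ := hv
  have h1 := nb_card_le hG v
  have h2 : 2 < (nb G v).card := Finset.two_lt_card.2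
    ⟨x, mem_nb.2 hx, y, mem_nb.2 hy, z, mem_nb.2 hz, hxy, hxz, hyz⟩
  omega

open Classical in
lemma cut_odd [Fintype W] {G : SimpleGraph W} (hG : Subcubic G) (S : Finset W)
    (h3 : ∀ v ∈ S, Has3 G v) (hS : Odd S.card) :
    Odd ((S.sigma (fun v => nb G v)).filter (fun p => p.2 ∉ S)).card := by
  have h1 := Finset.card_filter_add_card_filter_not (s := S.sigma (fun v => nb G v))
    (fun p => p.2 ∈ S)
  have h2 : (S.sigma (fun v => nb G v)).card = S.card * 3 := by
    rw [Finset.card_sigma, Finset.sum_congr rfl (fun v hv => nb_card_eq hG (h3 v hv)),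
      Finset.sum_const, smul_eq_mul]
  have h4 : Even ((S.sigma (fun v => nb G v)).filter (fun p => p.2 ∈ S)).card := by
    rw [← ZMod.natCast_eq_zero_iff_even, Finset.card_eq_sum_ones, Nat.cast_sum]
    refine Finset.sum_involution (fun p _ => ⟨p.2, p.1⟩) ?_ ?_ ?_ ?_
    · intro a _; decide
    · rintro ⟨a, b⟩ ha _ h
      simp only [Finset.mem_filter, Finset.mem_sigma, mem_nb] at ha
      have : b = a := congrArg Sigma.fst h
      exact ha.1.2.ne this.symm
    · rintro ⟨a, b⟩ ha
      simp only [Finset.mem_filter, Finset.mem_sigma, mem_nb] at ha ⊢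
      exact ⟨⟨ha.2, ha.1.2.symm⟩, ha.1.1⟩
    · rintro ⟨a, b⟩ ha
      rfl
  rw [h2] at h1
  obtain ⟨k, hk⟩ := h4
  obtain ⟨m, hm⟩ := hS
  rw [hk, hm] at h1
  refine ⟨3 * m + 1 - k, ?_⟩
  omega

open Classical in
lemma cut_three [Fintype W] {G : SimpleGraph W} (hG : Subcubic G) (hB : Bridgeless G)
    (S : Finset W) (h3 : ∀ v ∈ S, Has3 G v) (hS : Odd S.card) :
    3 ≤ ((S.sigma (fun v => nb G v)).filter (fun p => p.2 ∉ S)).card := by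
  have h1 := cut_odd hG S h3 hS
  obtain ⟨⟨u, v⟩, huv⟩ := Finset.card_pos.1 h1.pos
  have huv' := huv
  simp only [Finset.mem_filter, Finset.mem_sigma, mem_nb] at huv'
  obtain ⟨x, y, hx, hy, hxy, hne⟩ := hB (↑S) u v (by simpa using huv'.1.1) (by simpa using huv'.2)
    huv'.1.2
  have h2 : 1 < ((S.sigma (fun v => nb G v)).filter (fun p => p.2 ∉ S)).card := by
    refine Finset.one_lt_card.2 ⟨⟨u, v⟩, huv, ⟨x, y⟩, ?_, ?_⟩
    · simp only [Finset.mem_filter, Finset.mem_sigma, mem_nb]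
      exact ⟨⟨by simpa using hx, hxy⟩, by simpa using hy⟩
    · intro h
      apply hne
      exact ⟨(congrArg Sigma.fst h).symm, (congrArg Sigma.snd h).symm⟩
  obtain ⟨k, hk⟩ := h1
  omega

/-- The graph `G` with all vertices of small degree joined. -/
def aug (G : SimpleGraph W) : SimpleGraph W where
  Adj x y := G.Adj x y ∨ (x ≠ y ∧ ¬ Has3 G x ∧ ¬ Has3 G y)
  symm := ⟨fun x y h => h.imp (fun h => h.symm) (fun h => ⟨h.1.symm, h.2.2, h.2.1⟩)⟩
  loopless := ⟨fun x h => by rcases h with h | h; exacts [h.ne rfl, h.1 rfl]⟩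

lemma aug_matching [Finite W] {G : SimpleGraph W} (hG : Subcubic G) (hB : Bridgeless G)
    (hE : Even (Nat.card W)) : ∃ M : (aug G).Subgraph, M.IsPerfectMatching := by
  classical
  cases nonempty_fintype W
  rw [SimpleGraph.tutte]
  intro U hU
  unfold SimpleGraph.IsTutteViolator at hU
  set K := ((⊤ : (aug G).Subgraph).deleteVerts U).coe with hK
  have vU : ∀ v : ((⊤ : (aug G).Subgraph).deleteVerts U).verts, v.1 ∉ U := by
    intro v; have := v.2; simpa using this
  have adjK : ∀ a b : ((⊤ : (aug G).Subgraph).deleteVerts U).verts, (aug G).Adj a.1 b.1 →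
      K.Adj a b := by
    intro a b h
    rw [hK, Subgraph.coe_adj, Subgraph.deleteVerts_adj]
    exact ⟨by simp, vU a, by simp, vU b, by simpa using h⟩
  -- parity
  have hpar := SimpleGraph.odd_ncard_oddComponents K
  have hcard : Nat.card ((⊤ : (aug G).Subgraph).deleteVerts U).verts + U.ncard = Nat.card W := by
    have e : ((⊤ : (aug G).Subgraph).deleteVerts U).verts = Uᶜ := by
      ext v; simp
    rw [e, Nat.card_coe_set_eq, add_comm, Set.ncard_add_ncard_compl]
  have hge : U.ncard + 2 ≤ K.oddComponents.ncard := by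
    by_contra hcon
    have e : K.oddComponents.ncard = U.ncard + 1 := by omega
    rw [e] at hpar
    rw [← hcard] at hE
    by_cases h : Odd (U.ncard + 1)
    · have := hpar.1 h
      have h2 := this.add_odd h
      rw [Nat.even_iff] at hE h2
      omega
    · have : ¬ Odd _ := fun h' => h (hpar.2 h')
      rw [Nat.not_odd_iff] at h this
      rw [Nat.even_iff] at hE
      omega
  -- the vertex sets of the components
  let SC : K.ConnectedComponent → Finset W := fun C => (Subtype.val '' C.supp).toFinset
  have memSC : ∀ C (v : W), v ∈ SC C ↔ ∃ a : ((⊤ : (aug G).Subgraph).deleteVerts U).verts,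
      K.connectedComponentMk a = C ∧ a.1 = v := by
    intro C v
    simp only [SC, Set.mem_toFinset, Set.mem_image, SimpleGraph.ConnectedComponent.mem_supp_iff]
  have closed : ∀ C x y, x ∈ SC C → y ∉ U → (aug G).Adj x y → y ∈ SC C := by
    intro C x y hx hy hxy
    rw [memSC] at hx ⊢
    obtain ⟨a, ha, rfl⟩ := hx
    refine ⟨⟨y, by simpa using hy⟩, ?_, rfl⟩
    rw [← ha]
    exact (SimpleGraph.ConnectedComponent.sound (adjK a ⟨y, by simpa using hy⟩ hxy).reachable).symm
  have disj : ∀ C D x, x ∈ SC C → x ∈ SC D → C = D := by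
    intro C D x hC hD
    rw [memSC] at hC hD
    obtain ⟨a, ha, hax⟩ := hC
    obtain ⟨b, hb, hbx⟩ := hD
    have : a = b := Subtype.ext (hax.trans hbx.symm)
    rw [← ha, ← hb, this]
  have outU : ∀ C x, x ∈ SC C → x ∉ U := by
    intro C x h
    rw [memSC] at h
    obtain ⟨a, ha, rfl⟩ := h
    exact vU a
  -- the odd components
  let O : Finset K.ConnectedComponent := K.oddComponents.toFinset
  have hO : O.card = K.oddComponents.ncard := (Set.ncard_eq_toFinset_card' _).symm
  let B : Finset K.ConnectedComponent := O.filter (fun C => ∃ v ∈ SC C, ¬ Has3 G v)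
  let A : Finset K.ConnectedComponent := O.filter (fun C => ¬ ∃ v ∈ SC C, ¬ Has3 G v)
  have hAB : B.card + A.card = O.card := Finset.card_filter_add_card_filter_not _
  have hB1 : B.card ≤ 1 := by
    rw [Finset.card_le_one]
    intro C hC D hD
    simp only [B, Finset.mem_filter] at hC hD
    obtain ⟨-, x, hx, hx3⟩ := hC
    obtain ⟨-, y, hy, hy3⟩ := hD
    by_cases hxy : x = y
    · subst hxy; exact disj _ _ _ hx hy
    · exact disj C D y (closed C x y hx (outU D y hy) (Or.inr ⟨hxy, hx3, hy3⟩)) hy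
  let UF : Finset W := U.toFinset
  have hUF : UF.card = U.ncard := (Set.ncard_eq_toFinset_card' _).symm
  let N : K.ConnectedComponent → Finset (Σ _ : W, W) := fun C =>
    (UF.sigma (fun v => nb G v)).filter (fun p => p.2 ∈ SC C)
  have hN : ∀ C ∈ A, 3 ≤ (N C).card := by
    intro C hC
    simp only [A, O, Finset.mem_filter, Set.mem_toFinset] at hC
    obtain ⟨h1, h2⟩ := hC
    push Not at h2
    have hodd : Odd (SC C).card := by
      have h1' : Odd C.supp.ncard := h1
      rw [← Set.ncard_image_of_injective C.supp Subtype.val_injective,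
        Set.ncard_eq_toFinset_card'] at h1'
      exact h1'
    refine (cut_three hG hB (SC C) h2 hodd).trans ?_
    refine Finset.card_le_card_of_injOn (fun p => ⟨p.2, p.1⟩) ?_ ?_
    · rintro ⟨x, y⟩ hp
      simp only [Finset.coe_filter, Set.mem_ofPred_eq, Finset.mem_sigma, mem_nb, N, UF,
        Set.mem_toFinset] at hp ⊢
      refine ⟨⟨?_, hp.1.2.symm⟩, hp.1.1⟩
      by_contra hcon
      exact hp.2 (closed C x y hp.1.1 hcon (Or.inl hp.1.2))
    · rintro ⟨x, y⟩ _ ⟨x', y'⟩ _ h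
      have e1 : y = y' := congrArg Sigma.fst h
      have e2 : x = x' := congrArg Sigma.snd h
      rw [e1, e2]
  have hsum : A.card * 3 ≤ UF.card * 3 := by
    calc A.card * 3 ≤ ∑ C ∈ A, (N C).card := by
          rw [← smul_eq_mul]; exact Finset.card_nsmul_le_sum _ _ _ hN
      _ = (A.biUnion N).card := by
          rw [Finset.card_biUnion]
          intro C _ D _ hCD
          rw [Function.onFun, Finset.disjoint_left]
          intro p hp hq
          simp only [N, Finset.mem_filter] at hp hq
          exact hCD (disj C D _ hp.2 hq.2)
      _ ≤ (UF.sigma (fun v => nb G v)).card := by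
          apply Finset.card_le_card
          intro p hp
          rw [Finset.mem_biUnion] at hp
          obtain ⟨C, _, hC⟩ := hp
          exact (Finset.mem_filter.1 hC).1
      _ ≤ UF.card * 3 := by
          rw [Finset.card_sigma, ← smul_eq_mul]
          exact Finset.sum_le_card_nsmul _ _ _ (fun v _ => nb_card_le hG v)
  omega

/-- Two disjoint copies of `G`. -/
def dbl (G : SimpleGraph W) : SimpleGraph (W × Bool) where
  Adj x y := G.Adj x.1 y.1 ∧ x.2 = y.2
  symm := ⟨fun x y h => ⟨h.1.symm, h.2.symm⟩⟩
  loopless := ⟨fun x h => h.1.ne rfl⟩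

lemma exists_mu [Finite W] {G : SimpleGraph W} (hG : Subcubic G) (hB : Bridgeless G) :
    ∃ μ : W → W, (∀ v, μ (μ v) = v) ∧ (∀ v, μ v = v ∨ G.Adj v (μ v)) ∧
      ∀ v, Has3 G v → μ v ≠ v := by
  classical
  have h1 : Subcubic (dbl G) := by
    intro v x y z w hx hy hz hw
    have := hG v.1 x.1 y.1 z.1 w.1 hx.1 hy.1 hz.1 hw.1
    simp only [Prod.ext_iff, ← hx.2, ← hy.2, ← hz.2, ← hw.2, and_true]
    exact this
  have h2 : Bridgeless (dbl G) := by
    intro S u v hu hv huv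
    obtain ⟨x, y, hx, hy, hxy, hne⟩ := hB {x | (x, u.2) ∈ S} u.1 v.1 hu
      (fun h => hv (by have h' : (v.1, u.2) ∈ S := h
                       rw [huv.2] at h'; exact h')) huv.1
    refine ⟨(x, u.2), (y, u.2), hx, hy, ⟨hxy, rfl⟩, fun h => hne ⟨?_, ?_⟩⟩
    · rw [← h.1]
    · rw [← h.2]
  obtain ⟨M, hM⟩ := aug_matching h1 h2 (by rw [Nat.card_prod]; simp)
  have hM' : ∀ v, ∃ w, M.Adj v w ∧ ∀ w', M.Adj v w' → w' = w := by
    intro v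
    obtain ⟨w, h1, h2⟩ := hM.1 (hM.2 v)
    exact ⟨w, h1, h2⟩
  choose m hm hm' using hM'
  have h3 : ∀ v b, Has3 G v → Has3 (dbl G) (v, b) := by
    rintro v b ⟨x, y, z, hx, hy, hz, hxy, hxz, hyz⟩
    refine ⟨(x, b), (y, b), (z, b), ⟨hx, rfl⟩, ⟨hy, rfl⟩, ⟨hz, rfl⟩, ?_, ?_, ?_⟩
    · intro h; exact hxy (congrArg Prod.fst h)
    · intro h; exact hxz (congrArg Prod.fst h)
    · intro h; exact hyz (congrArg Prod.fst h)
  refine ⟨fun v => if (dbl G).Adj (v, false) (m (v, false)) then (m (v, false)).1 else v,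
    ?_, ?_, ?_⟩
  · intro v
    by_cases h : (dbl G).Adj (v, false) (m (v, false))
    · have e : ((m (v, false)).1, false) = m (v, false) := by
        ext
        · rfl
        · exact h.2
      have e' : m (m (v, false)) = (v, false) := (hm' _ _ (hm (v, false)).symm).symm
      simp only [h, if_true, e, e', h.symm]
    · simp only [h, if_false]
  · intro v
    by_cases h : (dbl G).Adj (v, false) (m (v, false))
    · simp only [h, if_true]
      exact Or.inr h.1
    · simp only [h, if_false, true_or]
  · intro v hv
    have h : (dbl G).Adj (v, false) (m (v, false)) := by
      rcases M.adj_sub (hm (v, false)) with h | h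
      · exact h
      · exact absurd (h3 v false hv) h.2.1
    simp only [h, if_true]
    exact h.1.ne'

end

/-! ### Avoiding triangles in the complement of the matching -/

section
variable {V : Type*}

/-- A matching covering the vertices of degree three and meeting all triangles. -/
def GoodMu (G : SimpleGraph V) (μ : V → V) : Prop :=
  (∀ v, μ (μ v) = v) ∧ (∀ v, μ v = v ∨ G.Adj v (μ v)) ∧ (∀ v, Has3 G v → μ v ≠ v) ∧
    ∀ a b c, G.Adj a b → G.Adj b c → G.Adj a c → μ a ≠ b → μ b ≠ c → μ a ≠ c → False

/-- `T` is the vertex set of a triangle. -/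
def IsTri (G : SimpleGraph V) (T : Set V) : Prop :=
  (∀ t ∈ T, ∃ r s, r ∈ T ∧ s ∈ T ∧ t ≠ r ∧ t ≠ s ∧ r ≠ s ∧ ∀ y ∈ T, y = t ∨ y = r ∨ y = s) ∧
    ∀ t ∈ T, ∀ u ∈ T, t ≠ u → G.Adj t u

/-- No vertex outside has two neighbours in `T`. -/
def IsoT (G : SimpleGraph V) (T : Set V) : Prop :=
  ∀ x, x ∉ T → ∀ t ∈ T, ∀ t' ∈ T, G.Adj x t → G.Adj x t' → t = t'

lemma isTri_of {G : SimpleGraph V} {a b c : V} (hab : G.Adj a b) (hbc : G.Adj b c)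
    (hac : G.Adj a c) : IsTri G {a, b, c} := by
  have n1 := hab.ne
  have n2 := hbc.ne
  have n3 := hac.ne
  constructor
  · intro t ht
    simp only [Set.mem_insert_iff, Set.mem_singleton_iff] at ht ⊢
    rcases ht with rfl | rfl | rfl
    · exact ⟨b, c, by simp, by simp, n1, n3, n2, fun y hy => hy⟩
    · exact ⟨a, c, by simp, by simp, n1.symm, n2, n3, fun y hy => by tauto⟩
    · exact ⟨a, b, by simp, by simp, n3.symm, n2.symm, n1, fun y hy => by tauto⟩
  · intro t ht t' ht' hne
    simp only [Set.mem_insert_iff, Set.mem_singleton_iff] at ht ht'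
    rcases ht with rfl | rfl | rfl <;> rcases ht' with rfl | rfl | rfl <;>
      first | exact absurd rfl hne | assumption | (apply SimpleGraph.Adj.symm; assumption)

lemma IsTri.one {G : SimpleGraph V} (hG : Subcubic G) {T : Set V} (hT : IsTri G T) {t x y : V}
    (ht : t ∈ T) (hx : x ∉ T) (hy : y ∉ T) (hxt : G.Adj t x) (hyt : G.Adj t y) : x = y := by
  obtain ⟨r, s, hr, hs, h1, h2, h3, -⟩ := hT.1 t ht
  rcases hG t r s x y (hT.2 t ht r hr h1) (hT.2 t ht s hs h2) hxt hyt with h | h | h | h | h | h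
  · exact absurd h h3
  · exact absurd (h ▸ hr) hx
  · exact absurd (h ▸ hr) hy
  · exact absurd (h ▸ hs) hx
  · exact absurd (h ▸ hs) hy
  · exact h

lemma goodMu_of_noIso [Finite V] {G : SimpleGraph V} (hG : Subcubic G) (hB : Bridgeless G)
    (h : ∀ T, T.Nonempty → IsTri G T → ¬ IsoT G T) : ∃ μ, GoodMu G μ := by
  obtain ⟨μ, h1, h2, h3⟩ := exists_mu hG hB
  refine ⟨μ, h1, h2, h3, ?_⟩
  intro a b c hab hbc hac nab nbc nac
  have hT := isTri_of hab hbc hac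
  have hn := h _ ⟨a, by simp⟩ hT
  have hin : ∀ t ∈ ({a, b, c} : Set V), ∀ t' ∈ ({a, b, c} : Set V), t ≠ t' → μ t ≠ t' := by
    have h1' : ∀ x y, μ x ≠ y → μ y ≠ x := fun x y h h' => h (by rw [← h', h1])
    intro t ht t' ht' hne
    simp only [Set.mem_insert_iff, Set.mem_singleton_iff] at ht ht'
    rcases ht with rfl | rfl | rfl <;> rcases ht' with rfl | rfl | rfl <;>
      first | exact absurd rfl hne | assumption | (apply h1'; assumption)
  generalize ({a, b, c} : Set V) = T at *
  unfold IsoT at hn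
  push Not at hn
  obtain ⟨x, hx, t, ht, t', ht', hxt, hxt', hne⟩ := hn
  have key : ∀ t ∈ T, G.Adj x t → μ t = x := by
    intro t ht hxt
    obtain ⟨r, s, hr, hs, k1, k2, k3, -⟩ := hT.1 t ht
    have a1 := hT.2 t ht r hr k1
    have a2 := hT.2 t ht s hs k2
    have e1 : r ≠ x := fun h => hx (h ▸ hr)
    have e2 : s ≠ x := fun h => hx (h ▸ hs)
    have hm := (h2 t).resolve_left (h3 t ⟨r, s, x, a1, a2, hxt.symm, k3, e1, e2⟩)
    rcases hG t r s x (μ t) a1 a2 hxt.symm hm with h | h | h | h | h | h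
    · exact absurd h k3
    · exact absurd h e1
    · exact absurd h.symm (hin t ht r hr k1)
    · exact absurd h e2
    · exact absurd h.symm (hin t ht s hs k2)
    · exact h.symm
  apply hne
  rw [← h1 t, ← h1 t', key t ht hxt, key t' ht' hxt']

open Classical in
/-- Contract `T` to `c`. -/
noncomputable def ctr (T : Set V) (c v : V) : V := if v ∈ T then c else v

/-- The contracted graph. -/
def cgr (G : SimpleGraph V) (T : Set V) (c : V) : SimpleGraph V where
  Adj x y := x ≠ y ∧ ∃ x' y', ctr T c x' = x ∧ ctr T c y' = y ∧ G.Adj x' y'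
  symm := ⟨fun x y h => ⟨h.1.symm, by
    obtain ⟨x', y', h1, h2, h3⟩ := h.2
    exact ⟨y', x', h2, h1, h3.symm⟩⟩⟩
  loopless := ⟨fun x h => h.1 rfl⟩

lemma ctr_in {T : Set V} {c v : V} (h : v ∈ T) : ctr T c v = c := by simp [ctr, h]
lemma ctr_out {T : Set V} {c v : V} (h : v ∉ T) : ctr T c v = v := by simp [ctr, h]

lemma ctr_eq {T : Set V} {c v w : V} (hw : w ∉ T) (hc : c ∈ T) (h : ctr T c v = w) : v = w := by
  by_cases hv : v ∈ T
  · rw [ctr_in hv] at h; exact absurd (h ▸ hc) hw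
  · rwa [ctr_out hv] at h

lemma ctr_eq_c {T : Set V} {c v : V} (hc : c ∈ T) (h : ctr T c v = c) : v ∈ T := by
  by_contra hv
  rw [ctr_out hv] at h; exact hv (h ▸ hc)

section contraction
variable {G : SimpleGraph V} {T : Set V} {c : V}

lemma cgr_adj_out (hc : c ∈ T) {x y : V} (hx : x ∉ T) (hy : y ∉ T) :
    (cgr G T c).Adj x y ↔ G.Adj x y := by
  constructor
  · rintro ⟨_, x', y', h1, h2, h3⟩
    rwa [ctr_eq hx hc h1, ctr_eq hy hc h2] at h3
  · intro h
    exact ⟨h.ne, x, y, ctr_out hx, ctr_out hy, h⟩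

lemma cgr_adj_c (hc : c ∈ T) {y : V} :
    (cgr G T c).Adj c y ↔ y ∉ T ∧ ∃ t ∈ T, G.Adj t y := by
  constructor
  · rintro ⟨h0, x', y', h1, h2, h3⟩
    have hy' : y' ∉ T := fun h => h0 (by rw [← h2, ctr_in h])
    rw [ctr_out hy'] at h2
    subst h2
    exact ⟨hy', x', ctr_eq_c hc h1, h3⟩
  · rintro ⟨h1, t, ht, h2⟩
    exact ⟨fun h => h1 (h ▸ hc), t, y, ctr_in ht, ctr_out h1, h2⟩

lemma cgr_adj_in (hc : c ∈ T) {x y : V} (hx : x ∈ T) (hxc : x ≠ c) : ¬ (cgr G T c).Adj x y := by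
  rintro ⟨h0, x', y', h1, h2, h3⟩
  by_cases h : x' ∈ T
  · rw [ctr_in h] at h1; exact hxc h1.symm
  · rw [ctr_out h] at h1; exact h (h1 ▸ hx)

lemma cgr_subcubic (hG : Subcubic G) (hT : IsTri G T) (hc : c ∈ T) : Subcubic (cgr G T c) := by
  intro v x y z w hx hy hz hw
  by_cases hv : v ∈ T
  · by_cases hvc : v = c
    · subst hvc
      rw [cgr_adj_c hc] at hx hy hz hw
      obtain ⟨hx, t1, h1, a1⟩ := hx
      obtain ⟨hy, t2, h2, a2⟩ := hy
      obtain ⟨hz, t3, h3, a3⟩ := hz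
      obtain ⟨hw, t4, h4, a4⟩ := hw
      obtain ⟨r, s, hr, hs, k1, k2, k3, k4⟩ := hT.1 v hc
      have p1 := k4 t1 h1
      have p2 := k4 t2 h2
      have p3 := k4 t3 h3
      have p4 := k4 t4 h4
      have e12 : t1 = t2 → x = y := fun e => hT.one hG h1 hx hy a1 (e ▸ a2)
      have e13 : t1 = t3 → x = z := fun e => hT.one hG h1 hx hz a1 (e ▸ a3)
      have e14 : t1 = t4 → x = w := fun e => hT.one hG h1 hx hw a1 (e ▸ a4)
      have e23 : t2 = t3 → y = z := fun e => hT.one hG h2 hy hz a2 (e ▸ a3)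
      have e24 : t2 = t4 → y = w := fun e => hT.one hG h2 hy hw a2 (e ▸ a4)
      have e34 : t3 = t4 → z = w := fun e => hT.one hG h3 hz hw a3 (e ▸ a4)
      clear a1 a2 a3 a4 h1 h2 h3 h4 k4 hx hy hz hw hT hG hr hs
      grind
    · exact absurd hx (cgr_adj_in hc hv hvc)
  · have lift : ∀ y, (cgr G T c).Adj v y → ∃ y', ctr T c y' = y ∧ G.Adj v y' := by
      rintro y ⟨_, v', y', h1, h2, h3⟩
      rw [ctr_eq hv hc h1] at h3
      exact ⟨y', h2, h3⟩
    obtain ⟨x', rfl, hx'⟩ := lift x hx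
    obtain ⟨y', rfl, hy'⟩ := lift y hy
    obtain ⟨z', rfl, hz'⟩ := lift z hz
    obtain ⟨w', rfl, hw'⟩ := lift w hw
    rcases hG v x' y' z' w' hx' hy' hz' hw' with h | h | h | h | h | h <;> rw [h] <;> simp

lemma cgr_lift_unique (hI : IsoT G T) (hc : c ∈ T) {x y u v : V} (h1 : G.Adj x y)
    (h2 : G.Adj u v) (hxu : ctr T c x = ctr T c u) (hyv : ctr T c y = ctr T c v)
    (hne : ctr T c x ≠ ctr T c y) : x = u ∧ y = v := by
  by_cases hx : x ∈ T
  · have hu : u ∈ T := by rw [ctr_in hx] at hxu; exact ctr_eq_c hc hxu.symm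
    have hy : y ∉ T := fun h => hne (by rw [ctr_in hx, ctr_in h])
    have e : v = y := ctr_eq hy hc (by rw [← hyv, ctr_out hy])
    subst e
    exact ⟨hI v hy x hx u hu h1.symm h2.symm, rfl⟩
  · have e : u = x := ctr_eq hx hc (by rw [← hxu, ctr_out hx])
    subst e
    refine ⟨rfl, ?_⟩
    by_cases hy : y ∈ T
    · have hv : v ∈ T := by rw [ctr_in hy] at hyv; exact ctr_eq_c hc hyv.symm
      exact hI u hx y hy v hv h1 h2
    · exact (ctr_eq hy hc (by rw [← hyv, ctr_out hy])).symm

lemma cgr_bridgeless (hB : Bridgeless G) (hI : IsoT G T) (hc : c ∈ T) :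
    Bridgeless (cgr G T c) := by
  intro S u v hu hv huv
  obtain ⟨hne, u, v, rfl, rfl, h⟩ := huv
  obtain ⟨x, y, hx, hy, hxy, hn⟩ := hB (ctr T c ⁻¹' S) u v hu hv h
  have hne' : ctr T c x ≠ ctr T c y := fun h => hy (by
    show ctr T c y ∈ S
    rw [← h]; exact hx)
  refine ⟨_, _, hx, hy, ⟨hne', x, y, rfl, rfl, hxy⟩, ?_⟩
  rintro ⟨h1, h2⟩
  exact hn (cgr_lift_unique hI hc hxy h h1 h2 hne')

lemma cgr_has3_out (hI : IsoT G T) (hc : c ∈ T) {v : V} (hv : v ∉ T) (h : Has3 G v) :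
    Has3 (cgr G T c) v := by
  obtain ⟨x, y, z, hx, hy, hz, hxy, hxz, hyz⟩ := h
  have ad : ∀ y, G.Adj v y → (cgr G T c).Adj v (ctr T c y) := by
    intro y hy
    refine ⟨?_, v, y, ctr_out hv, rfl, hy⟩
    intro h
    exact hy.ne (ctr_eq hv hc h.symm).symm
  have nn : ∀ x y, G.Adj v x → G.Adj v y → x ≠ y → ctr T c x ≠ ctr T c y := by
    intro x y hx hy hne h
    refine hne (cgr_lift_unique hI hc hx hy rfl h ?_).2
    rw [ctr_out hv]
    exact (ad x hx).1
  exact ⟨_, _, _, ad x hx, ad y hy, ad z hz, nn _ _ hx hy hxy, nn _ _ hx hz hxz, nn _ _ hy hz hyz⟩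

lemma IsTri.outside (hT : IsTri G T) {t : V} (ht : t ∈ T) (h : Has3 G t) :
    ∃ x, x ∉ T ∧ G.Adj t x := by
  by_contra hcon
  push Not at hcon
  obtain ⟨x, y, z, hx, hy, hz, hxy, hxz, hyz⟩ := h
  obtain ⟨r, s, hr, hs, k1, k2, k3, k4⟩ := hT.1 t ht
  have mem : ∀ w, G.Adj t w → w = r ∨ w = s := by
    intro w hw
    have : w ∈ T := by
      by_contra h; exact hcon w h hw
    exact (k4 w this).resolve_left hw.ne'
  have := mem x hx
  have := mem y hy
  have := mem z hz
  grind

lemma cgr_has3_c (hT : IsTri G T) (hI : IsoT G T) (hc : c ∈ T) (h : ∀ t ∈ T, Has3 G t) :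
    Has3 (cgr G T c) c := by
  obtain ⟨r, s, hr, hs, k1, k2, k3, -⟩ := hT.1 c hc
  obtain ⟨x, hx, ax⟩ := hT.outside hc (h c hc)
  obtain ⟨y, hy, ay⟩ := hT.outside hr (h r hr)
  obtain ⟨z, hz, az⟩ := hT.outside hs (h s hs)
  refine ⟨x, y, z, (cgr_adj_c hc).2 ⟨hx, c, hc, ax⟩, (cgr_adj_c hc).2 ⟨hy, r, hr, ay⟩,
    (cgr_adj_c hc).2 ⟨hz, s, hs, az⟩, ?_, ?_, ?_⟩
  · rintro rfl; exact k1 (hI x hx c hc r hr ax.symm ay.symm)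
  · rintro rfl; exact k2 (hI x hx c hc s hs ax.symm az.symm)
  · rintro rfl; exact k3 (hI y hy r hr s hs ay.symm az.symm)

lemma goodMu_lift (hG : Subcubic G) (hT : IsTri G T) (hI : IsoT G T) (hc : c ∈ T)
    {μ' : V → V} (h : GoodMu (cgr G T c) μ') : ∃ μ, GoodMu G μ := by
  classical
  obtain ⟨h1, h2, h3, h4⟩ := h
  -- the vertex of `T` to be matched outside
  obtain ⟨t, ht, x, hx⟩ : ∃ t ∈ T, ∃ x, (x ∉ T ∧ G.Adj t x ∧ μ' c = x) ∨
      (x = t ∧ μ' c = c ∧ ¬ Has3 G t) := by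
    rcases h2 c with h | h
    · have hn : ¬ ∀ t ∈ T, Has3 G t := fun h' => h3 c (cgr_has3_c hT hI hc h') h
      push Not at hn
      obtain ⟨t, ht, hn⟩ := hn
      exact ⟨t, ht, t, Or.inr ⟨rfl, h, hn⟩⟩
    · rw [cgr_adj_c hc] at h
      obtain ⟨hx, t, ht, ha⟩ := h
      exact ⟨t, ht, μ' c, Or.inl ⟨hx, ha, rfl⟩⟩
  obtain ⟨r, s, hr, hs, k1, k2, k3, k4⟩ := hT.1 t ht
  have fixed : ∀ v ∈ T, v ≠ c → μ' v = v := fun v hv hvc =>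
    (h2 v).resolve_right (cgr_adj_in hc hv hvc)
  have out : ∀ v, v ∉ T → v ≠ x → μ' v ∉ T ∧ μ' v ≠ x := by
    intro v hv hvx
    constructor
    · intro hm
      by_cases hmc : μ' v = c
      · have hv' : v = μ' c := by rw [← hmc, h1]
        rcases hx with hx | hx
        · exact hvx (hv'.trans hx.2.2)
        · exact hv (by rw [hv', hx.2.1]; exact hc)
      · have := fixed _ hm hmc
        rw [h1] at this
        exact hv (this ▸ hm)
    · intro hm
      rcases hx with hx | hx
      · have : v = c := by rw [← h1 v, hm, ← hx.2.2, h1]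
        exact hv (this ▸ hc)
      · rw [hx.1] at hm
        by_cases htc : t = c
        · have : v = c := by rw [← h1 v, hm, htc, hx.2.1]
          exact hv (this ▸ hc)
        · have : v = t := by rw [← h1 v, hm, fixed t ht htc]
          exact hv (this ▸ ht)
  let μ : V → V := fun v => if v = t then x else if v = x then t else if v = r then s else
    if v = s then r else μ' v
  have xr : x ≠ r := by
    rintro rfl; rcases hx with hx | hx
    · exact hx.1 hr
    · exact k1 hx.1.symm
  have xs : x ≠ s := by
    rintro rfl; rcases hx with hx | hx
    · exact hx.1 hs
    · exact k2 hx.1.symm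
  have mt : μ t = x := by simp [μ]
  have mx : μ x = t := by
    by_cases h : x = t
    · simp [μ, h]
    · simp [μ, h]
  have mr : μ r = s := by simp [μ, k1.symm, xr.symm]
  have ms : μ s = r := by simp [μ, k2.symm, xs.symm, k3.symm]
  have mo : ∀ v, v ∉ T → v ≠ x → μ v = μ' v := by
    intro v hv hvx
    have e1 : v ≠ t := fun h => hv (h ▸ ht)
    have e2 : v ≠ r := fun h => hv (h ▸ hr)
    have e3 : v ≠ s := fun h => hv (h ▸ hs)
    simp [μ, e1, e2, e3, hvx]
  have cases5 : ∀ v, v = t ∨ v = r ∨ v = s ∨ v = x ∨ (v ∉ T ∧ v ≠ x) := by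
    intro v
    by_cases hv : v ∈ T
    · rcases k4 v hv with h | h | h
      · exact Or.inl h
      · exact Or.inr (Or.inl h)
      · exact Or.inr (Or.inr (Or.inl h))
    · by_cases hvx : v = x
      · exact Or.inr (Or.inr (Or.inr (Or.inl hvx)))
      · exact Or.inr (Or.inr (Or.inr (Or.inr ⟨hv, hvx⟩)))
  have hrs := hT.2 r hr s hs k3
  have minv : ∀ v, μ (μ v) = v := by
    intro v
    rcases cases5 v with rfl | rfl | rfl | rfl | ⟨hv, hvx⟩
    · rw [mt, mx]
    · rw [mr, ms]
    · rw [ms, mr]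
    · rw [mx, mt]
    · have := out v hv hvx
      rw [mo v hv hvx, mo _ this.1 this.2, h1]
  refine ⟨μ, minv, ?_, ?_, ?_⟩
  · intro v
    rcases cases5 v with rfl | rfl | rfl | rfl | ⟨hv, hvx⟩
    · rw [mt]
      rcases hx with hx | hx
      · exact Or.inr hx.2.1
      · exact Or.inl hx.1
    · rw [mr]; exact Or.inr hrs
    · rw [ms]; exact Or.inr hrs.symm
    · rw [mx]
      rcases hx with hx | hx
      · exact Or.inr hx.2.1.symm
      · exact Or.inl hx.1.symm
    · rw [mo v hv hvx]
      refine (h2 v).imp_right fun h => ?_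
      rwa [cgr_adj_out hc hv (out v hv hvx).1] at h
  · intro v hv3
    rcases cases5 v with rfl | rfl | rfl | rfl | ⟨hv, hvx⟩
    · rw [mt]
      rcases hx with hx | hx
      · exact hx.2.1.ne'
      · exact absurd hv3 hx.2.2
    · rw [mr]; exact k3.symm
    · rw [ms]; exact k3
    · rw [mx]
      rcases hx with hx | hx
      · exact hx.2.1.ne
      · rw [hx.1] at hv3; exact absurd hv3 hx.2.2
    · rw [mo v hv hvx]
      exact h3 v (cgr_has3_out hI hc hv hv3)
  · -- two vertices in `T` force the third
    have two : ∀ p q w, G.Adj p q → G.Adj p w → G.Adj q w → q ≠ w → p ∈ T → q ∈ T := by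
      intro p q w hpq hpw hqw hne hp
      by_contra hq
      by_cases hw : w ∈ T
      · exact hpw.ne (hI q hq p hp w hw hpq.symm hqw)
      · exact hne (hT.one hG hp hq hw hpq hpw)
    intro p q w hpq hqw hpw npq nqw npw
    by_cases hp : p ∈ T
    · have hq := two p q w hpq hpw hqw hqw.ne hp
      have hw := two p w q hpw hpq hqw.symm hqw.ne' hp
      have e1 := k4 p hp
      have e2 := k4 q hq
      have e3 := k4 w hw
      have n1 := hpq.ne
      have n2 := hpw.ne
      have n3 := hqw.ne
      rcases e1 with rfl | rfl | rfl <;> rcases e2 with rfl | rfl | rfl <;>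
        rcases e3 with rfl | rfl | rfl <;>
        first | exact n1 rfl | exact n2 rfl | exact n3 rfl | exact npq mr | exact npq ms |
          exact nqw mr | exact nqw ms | exact npw mr | exact npw ms
    · have hq : q ∉ T := fun hq => hp (two q p w hpq.symm hqw hpw hpw.ne hq)
      have hw : w ∉ T := fun hw => hp (two w p q hpw.symm hqw.symm hpq hpq.ne hw)
      have tr : ∀ a b, a ∉ T → b ∉ T → μ a ≠ b → μ' a ≠ b := by
        intro a b ha hb hab
        by_cases hax : a = x
        · rcases hx with hx | hx
          · have : μ' a = c := by rw [hax, ← hx.2.2, h1]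
            rw [this]; intro h; exact hb (h ▸ hc)
          · exact absurd (by rw [hax, hx.1]; exact ht) ha
        · rwa [mo a ha hax] at hab
      exact h4 p q w ((cgr_adj_out hc hp hq).2 hpq) ((cgr_adj_out hc hq hw).2 hqw)
        ((cgr_adj_out hc hp hw).2 hpw) (tr p q hp hq npq) (tr q w hq hw nqw) (tr p w hp hw npw)

lemma cgr_support [Finite V] (hT : IsTri G T) (hc : c ∈ T) :
    (cgr G T c).support.ncard < G.support.ncard := by
  obtain ⟨r, s, hr, hs, k1, k2, k3, -⟩ := hT.1 c hc
  apply Set.ncard_lt_ncard _ (Set.toFinite _)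
  refine ⟨?_, fun h => ?_⟩
  · intro v hv
    rw [SimpleGraph.mem_support] at hv ⊢
    obtain ⟨w, _, v', w', h1, h2, h3⟩ := hv
    by_cases hv' : v' ∈ T
    · rw [ctr_in hv'] at h1
      exact ⟨r, h1 ▸ hT.2 c hc r hr k1⟩
    · rw [ctr_out hv'] at h1
      exact ⟨w', h1 ▸ h3⟩
  · have : r ∈ (cgr G T c).support := h ⟨c, (hT.2 c hc r hr k1).symm⟩
    rw [SimpleGraph.mem_support] at this
    obtain ⟨w, hw⟩ := this
    exact cgr_adj_in hc hr k1.symm hw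

end contraction

lemma exists_goodMu [Finite V] (n : ℕ) : ∀ (G : SimpleGraph V), G.support.ncard = n →
    Subcubic G → Bridgeless G → ∃ μ, GoodMu G μ := by
  induction n using Nat.strong_induction_on with
  | _ n ih =>
    intro G hn hG hB
    by_cases h : ∀ T, T.Nonempty → IsTri G T → ¬ IsoT G T
    · exact goodMu_of_noIso hG hB h
    · push Not at h
      obtain ⟨T, ⟨c, hc⟩, hT, hI⟩ := h
      obtain ⟨μ', h'⟩ := ih _ (hn ▸ cgr_support hT hc) (cgr G T c) rfl (cgr_subcubic hG hT hc)
        (cgr_bridgeless hB hI hc)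
      exact goodMu_lift hG hT hI hc h'

end

/-! ### Assembly -/

lemma good_of_bridgeless {V : Type*} [Finite V] {G : SimpleGraph V} (hG : Subcubic G)
    (hN : NoH2 G) (hB : Bridgeless G) : Good G := by
  obtain ⟨μ, h1, h2, h3, h4⟩ := exists_goodMu _ G rfl hG hB
  have h1' : ∀ x y, μ x ≠ y → μ y ≠ x := fun x y h h' => h (by rw [← h', h1])
  let F : SimpleGraph V :=
    { Adj := fun x y => G.Adj x y ∧ μ x ≠ y
      symm := ⟨fun x y h => ⟨h.1.symm, h1' _ _ h.2⟩⟩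
      loopless := ⟨fun x h => h.1.ne rfl⟩ }
  have hdeg : ∀ v x y z, F.Adj v x → F.Adj v y → F.Adj v z → x = y ∨ x = z ∨ y = z := by
    intro v x y z hx hy hz
    by_contra hcon
    push Not at hcon
    obtain ⟨c1, c2, c3⟩ := hcon
    have hm := (h2 v).resolve_left (h3 v ⟨x, y, z, hx.1, hy.1, hz.1, c1, c2, c3⟩)
    rcases hG v x y z (μ v) hx.1 hy.1 hz.1 hm with h | h | h | h | h | h
    · exact c1 h
    · exact c2 h
    · exact hx.2 h.symm
    · exact c3 h
    · exact hy.2 h.symm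
    · exact hz.2 h.symm
  obtain ⟨R, hR⟩ := exists_orient _ F rfl hdeg
  obtain ⟨σ, hσ⟩ := hR.exists_perm
  have S : Setup G μ R σ :=
    { inv := h1
      madj := h2
      adj := hR.adj
      asymm := hR.asymm
      out := hR.out
      inj := hR.inj
      perm := hσ
      tri := by
        intro x y z hxy hyz hzx
        have a1 := (hR.adj x y).2 (Or.inl hxy)
        have a2 := (hR.adj y z).2 (Or.inl hyz)
        have a3 := (hR.adj x z).2 (Or.inr hzx)
        exact h4 x y z a1.1 a2.1 a3.1 a1.2 a2.2 a3.2
      noH2 := hN }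
  exact S.good

lemma good_of_noH2 {V : Type*} [Finite V] (n : ℕ) : ∀ G : SimpleGraph V, G.edgeSet.ncard = n →
    Subcubic G → NoH2 G → Good G := by
  induction n using Nat.strong_induction_on with
  | _ n ih =>
    intro G hn hG hN
    by_cases hB : Bridgeless G
    · exact good_of_bridgeless hG hN hB
    · unfold Bridgeless at hB
      push Not at hB
      obtain ⟨S, u, v, hu, hv, huv, hcut⟩ := hB
      refine good_of_bridge hG S u v hu hv huv hcut ?_
      have hle : G.deleteEdges {s(u, v)} ≤ G := SimpleGraph.deleteEdges_le _
      refine ih _ ?_ _ rfl ?_ ?_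
      · rw [← hn]
        apply Set.ncard_lt_ncard _ (Set.toFinite _)
        refine ⟨SimpleGraph.edgeSet_mono hle, fun h => ?_⟩
        have h' : s(u, v) ∈ (G.deleteEdges {s(u, v)}).edgeSet := h huv
        rw [SimpleGraph.edgeSet_deleteEdges] at h'
        exact h'.2 rfl
      · intro v x y z w hx hy hz hw
        exact hG v x y z w (hle hx) (hle hy) (hle hz) (hle hw)
      · intro a b c d s q1 q2 q3 q4 q5 q6 q7
        exact hN a b c d s (hle q1) (hle q2) (hle q3) (hle q4) (hle q5) (hle q6) (hle q7)

lemma coloring_of_good {V : Type*} {G : SimpleGraph V} (h : Good G) :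
    ∃ f, IsPQColoring G.lineGraph 11 3 f := by
  obtain ⟨f, h1, h2⟩ := h
  refine ⟨fun e => f e.1, fun e => h1 e.1, ?_⟩
  rintro ⟨e, he⟩ ⟨e', he'⟩ hadj
  rw [SimpleGraph.lineGraph_adj_iff_exists] at hadj
  obtain ⟨hne, x, hx, hx'⟩ := hadj
  obtain ⟨y, rfl⟩ := Sym2.mem_iff_exists.1 hx
  obtain ⟨z, rfl⟩ := Sym2.mem_iff_exists.1 hx'
  have hyz : y ≠ z := by
    rintro rfl; exact hne rfl
  have := h2 x y z he he' hyz
  simp only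
  generalize f s(x, y) = a at *
  generalize f s(x, z) = b at *
  unfold Sep at this
  rcases abs_cases ((a : ℤ) - b) with ⟨h, _⟩ | ⟨h, _⟩ <;> rw [h] <;> push_cast <;> omega

end CCI

/-- There is no finite simple graph whose circular chromatic index lies strictly between
`11/3` and `4`: if the line graph of `G` admits a `(p,q)`-coloring for some positive integers
`p, q` with `p < 4q`, then it admits an `(11,3)`-coloring. -/
theorem no_circular_chromatic_index_between_eleven_thirds_and_four
    {V : Type*} [Fintype V] (G : SimpleGraph V)
    (h : ∃ p q : ℕ, 0 < p ∧ 0 < q ∧ p < 4 * q ∧ ∃ f, IsPQColoring G.lineGraph p q f) :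
    ∃ f, IsPQColoring G.lineGraph 11 3 f := by
  obtain ⟨p, q, hp, hq, hpq, f, hf⟩ := h
  obtain ⟨g, hr, hg⟩ := CCI.exists_total hp hf
  exact CCI.coloring_of_good (CCI.good_of_noH2 _ G rfl (CCI.subcubic_of_coloring hq hpq hr hg)
    (CCI.noH2_of_coloring hq hpq hr hg))
end

section
/- Let k > 2 and n be positive integers, and let c be a proper k-coloring (with colors 0,1,...,k−1) of a finite simple graph G such that the tight-arc digraph D_c(G) is acyclic and every directed path of D_c(G) contains at most n vertices of color k−1. Then G admits a (k(n+1)−1, n+1)-coloring; equivalently, the circular chromatic number of G is at most k − 1/(n+1). -/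
open SimpleGraph

/-- A proper `k`-coloring of `G` with colors `0, 1, ..., k-1`. -/
def IsProperColoring {V : Type*} (G : SimpleGraph V) (k : ℕ) (c : V → ℕ) : Prop :=
  (∀ v, c v < k) ∧ ∀ x y, G.Adj x y → c x ≠ c y

/-- `(x, y)` is a tight arc with respect to the `k`-coloring `c`: `x` and `y` are adjacent and
`c y ≡ c x + 1 (mod k)`.  The digraph `D_c(G)` has the tight arcs as its arcs. -/
def TightArc {V : Type*} (G : SimpleGraph V) (k : ℕ) (c : V → ℕ) (x y : V) : Prop :=
  G.Adj x y ∧ c y = (c x + 1) % k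

/-- The tight-arc digraph `D_c(G)` is acyclic: no vertex is reachable from itself by a
nontrivial directed walk of tight arcs. -/
def TightAcyclic {V : Type*} (G : SimpleGraph V) (k : ℕ) (c : V → ℕ) : Prop :=
  ∀ x, ¬ Relation.TransGen (TightArc G k c) x x

/-- Every chain of tight arcs in an acyclic tight digraph is duplicate free. -/
theorem tight_chain_nodup {V : Type*} (G : SimpleGraph V) (k : ℕ) (c : V → ℕ)
    (ha : TightAcyclic G k c) (l : List V) (hl : l.IsChain (TightArc G k c)) : l.Nodup := by
  have h1 : l.IsChain (Relation.TransGen (TightArc G k c)) :=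
    hl.imp (fun _ _ h => Relation.TransGen.single h)
  have h2 := h1.pairwise
  refine List.Pairwise.imp ?_ h2
  intro a b hab he
  subst he
  exact ha _ hab

/-- If `k > 2`, `n ≥ 1`, and `c` is a proper `k`-coloring of `G` whose tight-arc digraph
`D_c(G)` is acyclic and each of whose directed paths contains at most `n` vertices of color
`k-1`, then `G` admits a `(k(n+1)-1, n+1)`-coloring, i.e. the circular chromatic number of
`G` is at most `k - 1/(n+1)`. -/
theorem pq_coloring_of_tightAcyclic_path_bound
    {V : Type*} [Fintype V] (G : SimpleGraph V) (k n : ℕ) (hk : 2 < k) (hn : 0 < n)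
    (c : V → ℕ) (hc : IsProperColoring G k c)
    (hacyclic : TightAcyclic G k c)
    (hpath : ∀ l : List V, l.Chain' (TightArc G k c) → l.Nodup →
      (l.filter fun v => c v = k - 1).length ≤ n) :
    ∃ f, IsPQColoring G (k * (n + 1) - 1) (n + 1) f := by
  classical
  have hq : ∃ s : V → ℕ, (∀ v, s v ≤ n) ∧ (∀ v, c v = k - 1 → s v + 1 ≤ n) ∧
      (∀ x y, TightArc G k c x y → s x + (if c x = k - 1 then 1 else 0) ≤ s y) := by
    let P : V → ℕ → Prop := fun v m => ∃ l : List V, (l ++ [v]).IsChain (TightArc G k c) ∧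
      (l.filter fun v => c v = k - 1).length = m
    have hP0 : ∀ v, P v 0 := fun v => ⟨[], by simp, by simp⟩
    have hb : ∀ v m, P v m → m + (if c v = k - 1 then 1 else 0) ≤ n := by
      rintro v m ⟨l, hl, rfl⟩
      have := hpath _ hl (tight_chain_nodup G k c hacyclic _ hl)
      rw [List.filter_append, List.length_append] at this
      by_cases h : c v = k - 1
      · simpa [h] using this
      · simpa [h] using this
    have hs : ∀ v, P v (Nat.findGreatest (P v) n) := fun v =>
      Nat.findGreatest_spec (Nat.zero_le n) (hP0 v)
    refine ⟨fun v => Nat.findGreatest (P v) n, fun v => Nat.findGreatest_le n, ?_, ?_⟩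
    · intro v hv
      have := hb v _ (hs v)
      simpa [hv] using this
    · intro x y hxy
      refine Nat.le_findGreatest (hb x _ (hs x)) ?_
      obtain ⟨l, hl, hm⟩ := hs x
      refine ⟨l ++ [x], ?_, ?_⟩
      · refine List.IsChain.append hl (by simp) ?_
        intro a ha b hb
        simp at ha hb
        subst ha hb
        exact hxy
      · rw [List.filter_append, List.length_append, hm]
        by_cases h : c x = k - 1 <;> simp [h]
  obtain ⟨s, hs1, hs2, hs3⟩ := hq
  have hp : ((k * (n + 1) - 1 : ℕ) : ℤ) = (k : ℤ) * (n + 1) - 1 := by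
    have : 1 ≤ k * (n + 1) := Nat.mul_pos (by omega) (by omega)
    push_cast [this]
    ring
  -- the asymmetric version of the distance bounds
  have key : ∀ x y, G.Adj x y → c x < c y →
      ((n : ℤ) + 1) ≤ ((n + 1) * c y + s y : ℤ) - ((n + 1) * c x + s x) ∧
      ((n + 1) * c y + s y : ℤ) - ((n + 1) * c x + s x) ≤ (k : ℤ) * (n + 1) - 1 - (n + 1) := by
    intro x y hxy hlt
    have hy := hc.1 y
    have a1 := hs1 x
    have a2 := hs1 y
    obtain ⟨d, hd⟩ := Nat.exists_eq_add_of_lt hlt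
    have hdz : (c y : ℤ) = c x + d + 1 := by exact_mod_cast hd
    have e : ((n + 1) * c y + s y : ℤ) - ((n + 1) * c x + s x)
        = (n + 1) * (d + 1) + s y - s x := by rw [hdz]; ring
    rw [e]
    have lo : (n : ℤ) + 1 ≤ (n + 1) * (d + 1) + s y - s x := by
      rcases Nat.eq_zero_or_pos d with h0 | h0
      · have := hs3 x y ⟨hxy, by rw [Nat.mod_eq_of_lt (by omega)]; omega⟩
        have : s x ≤ s y := by omega
        subst h0
        push_cast
        linarith [(by exact_mod_cast this : (s x : ℤ) ≤ s y)]
      · have : ((n : ℤ) + 1) * 1 ≤ (n + 1) * d := by gcongr; exact_mod_cast h0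
        have : (s x : ℤ) ≤ n := by exact_mod_cast a1
        have : (0 : ℤ) ≤ s y := by positivity
        linarith
    refine ⟨lo, ?_⟩
    by_cases h : d + 2 = k
    · have h1 : c x = 0 := by omega
      have h2 : c y = k - 1 := by omega
      have := hs3 y x ⟨hxy.symm, by rw [h1, h2, Nat.sub_add_cancel (by omega), Nat.mod_self]⟩
      rw [if_pos h2] at this
      have : (s y : ℤ) + 1 ≤ s x := by exact_mod_cast this
      have hkz : (k : ℤ) = d + 2 := by exact_mod_cast h.symm
      rw [hkz]
      linarith
    · have h3 : d + 3 ≤ k := by omega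
      have : ((d : ℤ) + 3) * (n + 1) ≤ k * (n + 1) := by gcongr; exact_mod_cast h3
      have : (s y : ℤ) ≤ n := by exact_mod_cast a2
      have : (0 : ℤ) ≤ s x := by positivity
      linarith
  refine ⟨fun v => (n + 1) * c v + s v, ?_, ?_⟩
  · intro v
    have hv := hc.1 v
    have a1 := hs1 v
    zify
    rw [hp]
    by_cases h : c v = k - 1
    · have := hs2 v h
      have hz : (k : ℤ) = c v + 1 := by exact_mod_cast (by omega : k = c v + 1)
      have : (s v : ℤ) + 1 ≤ n := by exact_mod_cast this
      rw [hz]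
      linarith
    · have h3 : c v + 2 ≤ k := by omega
      have : ((c v : ℤ) + 2) * (n + 1) ≤ k * (n + 1) := by gcongr; exact_mod_cast h3
      have : (s v : ℤ) ≤ n := by exact_mod_cast a1
      linarith
  · intro x y hxy
    rw [hp]
    push_cast
    rcases lt_or_gt_of_ne (hc.2 x y hxy) with h | h
    · obtain ⟨h1, h2⟩ := key x y hxy h
      rw [abs_sub_comm, abs_of_nonneg (by linarith)]
      exact ⟨h1, h2⟩
    · obtain ⟨h1, h2⟩ := key y x hxy.symm h
      rw [abs_of_nonneg (by linarith)]
      exact ⟨h1, h2⟩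
end

section
/- Let G be a finite cubic (3-regular) simple graph of girth at least 4 that has a perfect matching. Then the line graph L(G) admits an (11,3)-coloring, i.e., the circular chromatic index of G is at most 11/3. -/
open SimpleGraph

namespace CubicEleven

/-- Symmetric weight matrix. Letters: `0,1` = pick of class `0,1`; `2,3` = near of class `0,1`;
`4` = far; `5` = neutral (the matching edge does not lead to another odd cycle). -/
def Wt : Fin 6 → Fin 6 → ℤ :=
  ![![4, -5, -2, 5, 5, -2], ![-5, 4, 5, -2, 5, -2], ![-2, 5, 5, 3, 6, -2],
    ![5, -2, 3, 5, 6, -2], ![5, 5, 6, 6, 0, 0], ![-2, -2, -2, -2, 0, 0]]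

lemma Wt_symm : ∀ a b, Wt a b = Wt b a := by decide

def U (s l : Fin 6) : ℤ := Wt s l - Wt 4 l

def pc (c : Bool) : Fin 6 := if c then 1 else 0
def nc (c : Bool) : Fin 6 := if c then 3 else 2

/-- A pick of class `c` conflicts with the letter `l`. -/
def Bad (c : Bool) (l : Fin 6) : Prop := l = pc (!c) ∨ l = nc c

instance (c l) : Decidable (Bad c l) := by unfold Bad; infer_instance

def pay (c : Bool) (a b d e : Fin 6) : ℤ := U (pc c) a + U (pc c) b + U (nc c) d + U (nc c) e

def HappyLe (v : ℤ) (a b d e : Fin 6) : Prop :=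
  (a = 5 ∧ e = 5) ∨ ∀ c, (¬ (Bad c a ∨ Bad c b) → pay c a b d e ≤ v) ∧
    (¬ (Bad c e ∨ Bad c d) → pay c e d b a ≤ v)

instance (v a b d e) : Decidable (HappyLe v a b d e) := by unfold HappyLe; infer_instance

def side (l : Fin 6) : Bool := l = 1 ∨ l = 2

def Alt (a b : Fin 6) : Prop := a.val < 4 ∧ b.val < 4 ∧ side a = ! side b
instance (a b) : Decidable (Alt a b) := by unfold Alt; infer_instance

set_option maxRecDepth 100000 in
set_option maxHeartbeats 4000000 in
lemma word_local : ∀ c a b d e, (Bad c a ∨ Bad c b) → HappyLe (pay c a b d e) a b d e →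
    ∀ f, HappyLe (pay c a b d e) b d e f →
      Alt a b ∧ Alt b d ∧ Alt d e ∧ pay c a b d e ≤ -12 := by decide

set_option maxRecDepth 100000 in
set_option maxHeartbeats 4000000 in
lemma word_step : ∀ a b, Alt a b → ∀ d, Alt b d → ∀ e, HappyLe (-12) a b d e → Alt d e := by
  decide

lemma HappyLe.mono {v v' a b d e} (h : HappyLe v a b d e) (hv : v ≤ v') : HappyLe v' a b d e := by
  rcases h with h | h
  · exact Or.inl h
  · exact Or.inr fun c => ⟨fun h' => ((h c).1 h').trans hv, fun h' => ((h c).2 h').trans hv⟩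

lemma cyclic_word (a : ℕ → Fin 6) (n : ℕ) (hn : Odd n) (hp : a n = a 0) (c : Bool)
    (h : ∀ i, HappyLe (pay c (a 0) (a 1) (a 2) (a 3)) (a i) (a (i+1)) (a (i+2)) (a (i+3))) :
    ¬ (Bad c (a 0) ∨ Bad c (a 1)) := by
  intro hb
  obtain ⟨h1, h2, h3, h4⟩ := word_local c _ _ _ _ hb (h 0) _ (h 1)
  have key : ∀ i, Alt (a i) (a (i+1)) ∧ Alt (a (i+1)) (a (i+2)) := by
    intro i
    induction i with
    | zero => exact ⟨h1, h2⟩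
    | succ i ih => exact ⟨ih.2, word_step _ _ ih.1 _ ih.2 _ ((h i).mono h4)⟩
  have par : ∀ i, side (a i) = (if Even i then side (a 0) else ! side (a 0)) := by
    intro i
    induction i with
    | zero => simp
    | succ i ih =>
      have := (key i).1.2.2
      rw [ih] at this
      by_cases he : Even i
      · simp [he, Nat.even_add_one] at this ⊢
        rw [this]; simp
      · simp [he, Nat.even_add_one] at this ⊢
        rw [this]
  have := par n
  rw [hp] at this
  simp [Nat.not_even_iff_odd.2 hn] at this


section Perm

set_option linter.unusedSectionVars false

variable {V : Type*} [Fintype V] [DecidableEq V]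

/-- `x` lies on a cycle of odd length of `π`. -/
def OddV (π : Equiv.Perm V) (x : V) : Prop := Odd (Function.minimalPeriod π x)

/-- Status of the vertices on a cycle choosing the window starting at `w` in direction `τ`. -/
def ws (τ : Equiv.Perm V) (w : V) (c : Bool) (x : V) : Fin 6 :=
  if x = w ∨ x = τ w then pc c else if x = τ (τ w) ∨ x = τ (τ (τ w)) then nc c else 4

/-- The hypotheses on the permutation `π` and the matching involution `m`. -/
structure Setup (π : Equiv.Perm V) (m : V → V) : Prop where
  inv : ∀ x, m (m x) = x
  m1 : ∀ x, m x ≠ π x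
  m2 : ∀ x, m x ≠ π (π x)
  p1 : ∀ x, π x ≠ x
  p3 : ∀ x, π (π (π x)) ≠ x

lemma sameCycle_oddV {π : Equiv.Perm V} {x y : V} (h : π.SameCycle x y) :
    OddV π x ↔ OddV π y := by
  obtain ⟨i, -, rfl⟩ := h.exists_pow_eq'
  unfold OddV
  have : Function.minimalPeriod π ((π ^ i) x) = Function.minimalPeriod π x := by
    rw [Equiv.Perm.coe_pow]
    apply Function.minimalPeriod_apply_iterate
    exact Function.mem_periodicPts.2
      ⟨orderOf π, orderOf_pos π, by
        rw [Function.IsPeriodicPt, Function.IsFixedPt, ← Equiv.Perm.coe_pow, pow_orderOf_eq_one]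
        rfl⟩
  rw [this]

def Dir (π τ : Equiv.Perm V) : Prop := τ = π ∨ τ = π⁻¹

lemma Dir.inv {π τ : Equiv.Perm V} (h : Dir π τ) : Dir π τ⁻¹ := by
  rcases h with rfl | rfl
  · exact Or.inr rfl
  · exact Or.inl (inv_inv _)

lemma Dir.sameCycle_iff {π τ : Equiv.Perm V} (h : Dir π τ) (x y : V) :
    τ.SameCycle x y ↔ π.SameCycle x y := by
  rcases h with rfl | rfl
  · rfl
  · exact Equiv.Perm.sameCycle_inv

lemma Dir.sc {π τ : Equiv.Perm V} (h : Dir π τ) (x : V) : π.SameCycle x (τ x) :=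
  (h.sameCycle_iff _ _).1 (Equiv.Perm.SameCycle.refl _ _).apply_right

lemma minimalPeriod_inv (π : Equiv.Perm V) (x : V) :
    Function.minimalPeriod (π⁻¹ : Equiv.Perm V) x = Function.minimalPeriod π x := by
  have key : ∀ n, Function.IsPeriodicPt (π⁻¹ : Equiv.Perm V) n x ↔
      Function.IsPeriodicPt π n x := by
    intro n
    rw [Function.IsPeriodicPt, Function.IsPeriodicPt, Function.IsFixedPt, Function.IsFixedPt,
      ← Equiv.Perm.coe_pow, ← Equiv.Perm.coe_pow, inv_pow, Equiv.Perm.inv_eq_iff_eq]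
    exact eq_comm
  apply Nat.dvd_antisymm
  · exact ((key _).2 (Function.isPeriodicPt_minimalPeriod _ _)).minimalPeriod_dvd
  · exact ((key _).1 (Function.isPeriodicPt_minimalPeriod _ _)).minimalPeriod_dvd

lemma Dir.minimalPeriod {π τ : Equiv.Perm V} (h : Dir π τ) (x : V) :
    Function.minimalPeriod τ x = Function.minimalPeriod π x := by
  rcases h with rfl | rfl
  · rfl
  · exact minimalPeriod_inv _ _

lemma OddV.ne2 {π : Equiv.Perm V} {m : V → V} (S : Setup π m) {x : V} (h : OddV π x) :
    π (π x) ≠ x := by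
  intro h2
  have hd : Function.minimalPeriod π x ∣ 2 := by
    apply Function.IsPeriodicPt.minimalPeriod_dvd
    exact h2
  have h1 : Function.minimalPeriod π x = 1 := by
    rcases (Nat.dvd_prime Nat.prime_two).1 hd with h' | h'
    · exact h'
    · unfold OddV at h; rw [h'] at h; exact absurd h (by decide)
  exact S.p1 x (Function.minimalPeriod_eq_one_iff_isFixedPt.1 h1)

/-- the mirror-image setup -/
lemma Setup.inv' {π : Equiv.Perm V} {m : V → V} (S : Setup π m) : Setup π⁻¹ m where
  inv := S.inv
  m1 x h := by
    have := S.m1 (m x)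
    rw [S.inv] at this
    apply this
    rw [h]; simp
  m2 x h := by
    have := S.m2 (m x)
    rw [S.inv] at this
    apply this
    rw [h]; simp
  p1 x h := S.p1 x (by nth_rewrite 1 [← h]; simp)
  p3 x h := S.p3 x (by nth_rewrite 1 [← h]; simp)

lemma Setup.dir {π τ : Equiv.Perm V} {m : V → V} (S : Setup π m) (h : Dir π τ) : Setup τ m := by
  rcases h with rfl | rfl
  · exact S
  · exact S.inv'

lemma Dir.oddV {π τ : Equiv.Perm V} (h : Dir π τ) {x : V} : OddV τ x ↔ OddV π x := by
  unfold OddV; rw [h.minimalPeriod]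

lemma sum_window {τ : Equiv.Perm V} {m : V → V} (S : Setup τ m) {w : V} (h : OddV τ w)
    (c : Bool) (l : V → Fin 6) (D : V → Prop) [DecidablePred D] (hD : ∀ x, D x → D (τ x))
    (hw : D w) :
    ∑ x, (if D x then U (ws τ w c x) (l x) else 0) =
      pay c (l w) (l (τ w)) (l (τ (τ w))) (l (τ (τ (τ w)))) := by
  have i1 := S.p1
  have i2 : τ (τ w) ≠ w := h.ne2 S
  have i3 := S.p3
  have n01 : w ≠ τ w := (i1 w).symm
  have n02 : w ≠ τ (τ w) := i2.symm
  have n03 : w ≠ τ (τ (τ w)) := (i3 w).symm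
  have n12 : τ w ≠ τ (τ w) := fun h => n01 (τ.injective h)
  have n13 : τ w ≠ τ (τ (τ w)) := fun h => n02 (τ.injective h)
  have n23 : τ (τ w) ≠ τ (τ (τ w)) := fun h => n12 (τ.injective h)
  rw [← Finset.sum_subset (Finset.subset_univ {w, τ w, τ (τ w), τ (τ (τ w))})]
  · rw [Finset.sum_insert (by simp [n01, n02, n03]), Finset.sum_insert (by simp [n12, n13]),
      Finset.sum_insert (by simp [n23]), Finset.sum_singleton]
    have d1 := hD _ hw
    have d2 := hD _ d1
    have d3 := hD _ d2
    simp only [hw, d1, d2, d3, if_true]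
    have e0 : ws τ w c w = pc c := by simp [ws]
    have e1 : ws τ w c (τ w) = pc c := by simp [ws]
    have e2 : ws τ w c (τ (τ w)) = nc c := by simp [ws, n02.symm, n12.symm]
    have e3 : ws τ w c (τ (τ (τ w))) = nc c := by
      unfold ws
      rw [if_neg (by rintro (h | h); exacts [n03 h.symm, n13 h.symm]), if_pos (Or.inr rfl)]
    rw [e0, e1, e2, e3, pay]; ring
  · intro x _ hx
    simp only [Finset.mem_insert, Finset.mem_singleton, not_or] at hx
    simp [ws, hx, U]

open Classical in
noncomputable def letter (π : Equiv.Perm V) (m : V → V) (s : V → Fin 6) (x : V) : Fin 6 :=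
  if OddV π (m x) ∧ ¬ π.SameCycle x (m x) then s (m x) else 5

open Classical in
noncomputable def Hh (π : Equiv.Perm V) (s : V → Fin 6) (x : V) : ℤ :=
  if OddV π x then Wt (s x) 5 else 0

open Classical in
noncomputable def En (π : Equiv.Perm V) (m : V → V) (s : V → Fin 6) (x : V) : ℤ :=
  if OddV π x ∧ OddV π (m x) ∧ ¬ π.SameCycle x (m x) then Wt (s x) (s (m x))
  else Hh π s x + Hh π s (m x)

def Valid (π : Equiv.Perm V) (m : V → V) (s : V → Fin 6) : Prop :=
  ∀ v, OddV π v → ∃ w τ c, Dir π τ ∧ π.SameCycle v w ∧ m w ≠ τ (τ (τ w)) ∧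
    ∀ x, π.SameCycle v x → s x = ws τ w c x

open Classical in
lemma En_diff {π : Equiv.Perm V} {m : V → V} (S : Setup π m) {v : V} (hv : OddV π v)
    (s s' : V → Fin 6) (hs : ∀ x, ¬ π.SameCycle v x → s' x = s x) (x : V) :
    En π m s' x - En π m s x =
      (if π.SameCycle v x then Wt (s' x) (letter π m s x) - Wt (s x) (letter π m s x) else 0) +
      (if π.SameCycle v (m x) then Wt (s' (m x)) (letter π m s (m x)) -
        Wt (s (m x)) (letter π m s (m x)) else 0) := by
  have hodd : ∀ y, π.SameCycle v y → OddV π y := fun y hy => (sameCycle_oddV hy).1 hv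
  by_cases hc : OddV π x ∧ OddV π (m x) ∧ ¬ π.SameCycle x (m x)
  · have l1 : letter π m s x = s (m x) := by simp [letter, hc.2]
    have hc' : ¬ π.SameCycle (m x) x := fun h => hc.2.2 h.symm
    have l2 : letter π m s (m x) = s x := by simp [letter, S.inv, hc.1, hc']
    simp only [En, if_pos hc, l1, l2]
    by_cases h1 : π.SameCycle v x
    · have h2 : ¬ π.SameCycle v (m x) := fun h => hc.2.2 (h1.symm.trans h)
      simp [h1, h2, hs _ h2]
    · by_cases h2 : π.SameCycle v (m x)
      · simp [h1, h2, hs _ h1, Wt_symm (s x)]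
      · simp [h1, h2, hs _ h1, hs _ h2]
  · simp only [En, if_neg hc]
    have aux : ∀ y, (π.SameCycle v y → letter π m s y = 5) → Hh π s' y - Hh π s y =
      (if π.SameCycle v y then Wt (s' y) (letter π m s y) - Wt (s y) (letter π m s y) else 0) := by
      intro y hy
      by_cases h1 : π.SameCycle v y
      · simp [h1, hy h1, Hh, hodd y h1]
      · simp [h1, Hh, hs y h1]
    rw [← aux x, ← aux (m x)]
    · ring
    · intro h
      unfold letter
      rw [if_neg]
      rw [S.inv]
      exact fun h' => hc ⟨h'.1, hodd _ h, fun h'' => h'.2 h''.symm⟩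
    · intro h
      unfold letter
      rw [if_neg]
      exact fun h' => hc ⟨hodd _ h, h'⟩

/-- Local optimality: changing the window on one odd cycle does not improve the payoff. -/
lemma local_opt {π : Equiv.Perm V} {m : V → V} (S : Setup π m) (s : V → Fin 6)
    (hs : Valid π m s) (hmax : ∀ s', Valid π m s' → ∑ x, En π m s' x ≤ ∑ x, En π m s x)
    {v : V} (hv : OddV π v) {w w' : V} {τ τ' : Equiv.Perm V} {c c' : Bool}
    (hτ : Dir π τ) (hτ' : Dir π τ') (hw : π.SameCycle v w) (hw' : π.SameCycle v w')
    (hf : m w' ≠ τ' (τ' (τ' w'))) (hsw : ∀ x, π.SameCycle v x → s x = ws τ w c x) :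
    pay c' (letter π m s w') (letter π m s (τ' w')) (letter π m s (τ' (τ' w')))
      (letter π m s (τ' (τ' (τ' w')))) ≤
    pay c (letter π m s w) (letter π m s (τ w)) (letter π m s (τ (τ w)))
      (letter π m s (τ (τ (τ w)))) := by
  classical
  set s' : V → Fin 6 := fun x => if π.SameCycle v x then ws τ' w' c' x else s x with hs'
  have hval : Valid π m s' := by
    intro u hu
    by_cases h : π.SameCycle v u
    · refine ⟨w', τ', c', hτ', h.symm.trans hw', hf, fun x hx => ?_⟩
      simp [hs', h.trans hx]
    · obtain ⟨w₁, τ₁, c₁, a1, a2, a3, a4⟩ := hs u hu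
      refine ⟨w₁, τ₁, c₁, a1, a2, a3, fun x hx => ?_⟩
      have : ¬ π.SameCycle v x := fun h' => h (h'.trans hx.symm)
      simp [hs', this, a4 x hx]
  have hle := hmax s' hval
  have hdiff : ∑ x, (En π m s' x - En π m s x) ≤ 0 := by
    rw [Finset.sum_sub_distrib]; linarith
  have hoff : ∀ x, ¬ π.SameCycle v x → s' x = s x := fun x hx => by simp [hs', hx]
  rw [Finset.sum_congr rfl (fun x _ => En_diff S hv s s' hoff x), Finset.sum_add_distrib] at hdiff
  let me : V ≃ V := Function.Involutive.toPerm m S.inv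
  have hre := Equiv.sum_comp me (fun x => if π.SameCycle v x then
    Wt (s' x) (letter π m s x) - Wt (s x) (letter π m s x) else 0)
  change ∑ x, (if π.SameCycle v (m x) then Wt (s' (m x)) (letter π m s (m x)) -
        Wt (s (m x)) (letter π m s (m x)) else 0) = _ at hre
  rw [hre] at hdiff
  have ho : OddV τ w := hτ.oddV.2 ((sameCycle_oddV hw).1 hv)
  have ho' : OddV τ' w' := hτ'.oddV.2 ((sameCycle_oddV hw').1 hv)
  have e1 := sum_window (S.dir hτ) ho c (letter π m s) (fun x => π.SameCycle v x)
    (fun x hx => hx.trans (hτ.sc x)) hw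
  have e2 := sum_window (S.dir hτ') ho' c' (letter π m s) (fun x => π.SameCycle v x)
    (fun x hx => hx.trans (hτ'.sc x)) hw'
  rw [← e1, ← e2, ← sub_nonpos, ← Finset.sum_sub_distrib]
  have : ∀ x, ((if π.SameCycle v x then U (ws τ' w' c' x) (letter π m s x) else 0) -
      (if π.SameCycle v x then U (ws τ w c x) (letter π m s x) else 0)) =
      (if π.SameCycle v x then
        Wt (s' x) (letter π m s x) - Wt (s x) (letter π m s x) else 0) := by
    intro x
    by_cases h : π.SameCycle v x
    · simp [h, U, hs', hsw x h]
    · simp [h]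
  rw [Finset.sum_congr rfl (fun x _ => this x)]
  linarith

lemma happy {π : Equiv.Perm V} {m : V → V} (S : Setup π m) (s : V → Fin 6)
    (hs : Valid π m s) (hmax : ∀ s', Valid π m s' → ∑ x, En π m s' x ≤ ∑ x, En π m s x)
    {v : V} (hv : OddV π v) {w : V} {τ : Equiv.Perm V} {c : Bool}
    (hτ : Dir π τ) (hw : π.SameCycle v w) 
    (hsw : ∀ x, π.SameCycle v x → s x = ws τ w c x) :
    ¬ (Bad c (letter π m s w) ∨ Bad c (letter π m s (τ w))) := by
  have ho : OddV π w := (sameCycle_oddV hw).1 hv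
  refine cyclic_word (fun i => letter π m s ((τ ^ i) w)) (Function.minimalPeriod π w) ho ?_ c ?_
  · have : (τ ^ Function.minimalPeriod π w) w = w := by
      rw [← hτ.minimalPeriod, Equiv.Perm.coe_pow]
      exact Function.isPeriodicPt_minimalPeriod τ w
    simp [this]
  · intro i
    set y := (τ ^ i) w with hy
    have hinv : ∀ z, τ⁻¹ (τ z) = z := fun z => by simp
    have y1 : (τ ^ (i+1)) w = τ y := by rw [pow_succ']; rfl
    have y2 : (τ ^ (i+2)) w = τ (τ y) := by rw [pow_succ', Equiv.Perm.mul_apply, y1]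
    have y3 : (τ ^ (i+3)) w = τ (τ (τ y)) := by rw [pow_succ', Equiv.Perm.mul_apply, y2]
    have hvy : π.SameCycle v y := hw.trans ((hτ.sameCycle_iff _ _).1 ⟨i, by simp [hy]⟩)
    have hvy3 : π.SameCycle v (τ (τ (τ y))) :=
      ((hvy.trans (hτ.sc _)).trans (hτ.sc _)).trans (hτ.sc _)
    simp only [y1, y2, y3, pow_zero, pow_one, Equiv.Perm.coe_one, id]
    have z2 : (τ ^ 2) w = τ (τ w) := rfl
    have z3 : (τ ^ 3) w = τ (τ (τ w)) := rfl
    rw [z2, z3]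
    by_cases hf : m y = τ (τ (τ y))
    · left
      constructor
      · unfold letter
        rw [if_neg]
        rw [hf]
        exact fun h => h.2 (hvy.symm.trans hvy3)
      · unfold letter
        rw [if_neg]
        rw [← hf, S.inv]
        intro h
        exact h.2 (by rw [hf]; exact hvy3.symm.trans hvy)
    · right
      intro c'
      refine ⟨fun _ => local_opt S s hs hmax hv hτ hτ hw hvy hf hsw, fun _ => ?_⟩
      have := local_opt (c' := c') S s hs hmax hv hτ hτ.inv hw hvy3 
        (by
          intro h
          apply hf
          simp only [hinv] at h
          have h' := congrArg m h
          rw [S.inv] at h'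
          exact h'.symm) hsw
      simpa only [hinv] using this

lemma exists_valid {π : Equiv.Perm V} {m : V → V} (S : Setup π m) : ∃ s, Valid π m s := by
  classical
  have hrep : ∀ q : Quotient (Equiv.Perm.SameCycle.setoid π), ∃ w : V,
      Quotient.mk _ w = q ∧ (OddV π w → m w ≠ π (π (π w))) := by
    intro q
    obtain ⟨r, rfl⟩ := Quotient.exists_rep q
    by_cases h : m r = π (π (π r))
    · refine ⟨π (π (π r)), ?_, fun ho => ?_⟩
      · apply Quotient.sound
        exact ((((Equiv.Perm.SameCycle.refl π r).apply_right).apply_right).apply_right).symm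
      · intro h'
        have := S.inv r
        rw [h, h'] at this
        have h6 : Function.minimalPeriod π r ∣ 6 := by
          apply Function.IsPeriodicPt.minimalPeriod_dvd
          exact this
        have ho' : OddV π r := by
          refine (sameCycle_oddV ?_).1 ho
          exact ((((Equiv.Perm.SameCycle.refl π r).apply_right).apply_right).apply_right).symm
        have h3 : Function.minimalPeriod π r ∣ 3 := by
          have : Nat.Coprime (Function.minimalPeriod π r) 2 := Nat.coprime_two_right.2 ho'
          exact this.dvd_of_dvd_mul_left (show _ ∣ 2 * 3 from h6)
        exact S.p3 r ((Function.isPeriodicPt_iff_minimalPeriod_dvd.2 h3))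
    · exact ⟨r, rfl, fun _ => h⟩
  choose rep hrep using hrep
  refine ⟨fun x => ws π (rep (Quotient.mk _ x)) true x, fun v hv => ?_⟩
  have hvw : π.SameCycle v (rep (Quotient.mk _ v)) := by
    have := Quotient.exact (hrep (Quotient.mk _ v)).1
    exact Equiv.Perm.SameCycle.symm this
  refine ⟨rep (Quotient.mk _ v), π, true, Or.inl rfl, hvw,
    (hrep _).2 ((sameCycle_oddV hvw).1 hv), fun x hx => ?_⟩
  have : (Quotient.mk (Equiv.Perm.SameCycle.setoid π) x) = Quotient.mk _ v :=
    Quotient.sound hx.symm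
  simp only [this]

open Classical in
noncomputable def lab (π : Equiv.Perm V) (m : V → V) (s : V → Fin 6) (x : V) : ℕ :=
  if (OddV π x ∧ s x = 0) ∨ (OddV π (m x) ∧ s (m x) = 0) then 0
  else if (OddV π x ∧ s x = 1) ∨ (OddV π (m x) ∧ s (m x) = 1) then 2 else 1

lemma exists_labels {π : Equiv.Perm V} {m : V → V} (S : Setup π m) :
    ∃ l : V → ℕ, (∀ x, l (m x) = l x) ∧ (∀ x, l x ≤ 2) ∧
      ∀ v, OddV π v → ∃ w τ, Dir π τ ∧ π.SameCycle v w ∧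
        ((l w = 0 ∧ l (τ w) = 0 ∧ l (τ (τ w)) ≠ 0 ∧ l (τ (τ (τ w))) ≠ 0) ∨
         (l w = 2 ∧ l (τ w) = 2 ∧ l (τ (τ w)) ≠ 2 ∧ l (τ (τ (τ w))) ≠ 2)) := by
  classical
  obtain ⟨s, hs, hmax⟩ : ∃ s, Valid π m s ∧
      ∀ s', Valid π m s' → ∑ x, En π m s' x ≤ ∑ x, En π m s x := by
    obtain ⟨s0, h0⟩ := exists_valid S
    obtain ⟨s, h1, h2⟩ := Finset.exists_max_image (Finset.univ.filter (Valid π m))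
      (fun s => ∑ x, En π m s x) ⟨s0, by simp [h0]⟩
    exact ⟨s, by simpa using h1, fun s' hs' => h2 s' (by simp [hs'])⟩
  have pn : ∀ c c', pc c ≠ nc c' := by decide
  have pinj : ∀ c c', pc c = pc c' → c = c' := by decide
  have bp : ∀ c, ¬ Bad c (pc c) := by decide
  have b4 : ∀ c, ¬ Bad c 4 := by decide
  have p4 : ∀ c, pc c ≠ 4 := by decide
  have n4 : ∀ c, nc c ≠ 4 := by decide
  have nocon : ∀ c x, OddV π x → s x = pc c → OddV π (m x) → ¬ Bad c (s (m x)) := by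
    intro c x hx hsx hmx
    obtain ⟨w, τ, c', hτ, hw, hf, hws⟩ := hs x hx
    have hh := happy S s hs hmax hx hτ hw hws
    have Sτ := S.dir hτ
    have hx' := hws x (Equiv.Perm.SameCycle.refl _ _)
    rw [hsx] at hx'
    have hxw : (x = w ∨ x = τ w) ∧ c' = c := by
      unfold ws at hx'
      split_ifs at hx' with h1 h2
      · exact ⟨h1, (pinj _ _ hx').symm⟩
      · exact absurd hx' (pn _ _)
      · exact absurd hx' (p4 _)
    obtain ⟨hxw, rfl⟩ := hxw
    by_cases hsc : π.SameCycle x (m x)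
    · rw [hws _ hsc]
      unfold ws
      split_ifs with h1 h2
      · exact bp _
      · exfalso
        rcases hxw with rfl | rfl
        · rcases h2 with h2 | h2
          · exact Sτ.m2 _ h2
          · exact hf h2
        · rcases h2 with h2 | h2
          · exact Sτ.m1 _ h2
          · exact Sτ.m2 _ h2
      · exact b4 _
    · have : letter π m s x = s (m x) := by
        unfold letter; rw [if_pos ⟨hmx, hsc⟩]
      rw [← this]
      rcases hxw with rfl | rfl
      · exact fun h => hh (Or.inl h)
      · exact fun h => hh (Or.inr h)
  have near : ∀ c y, OddV π y → s y = nc c →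
      ¬ ((OddV π y ∧ s y = pc c) ∨ (OddV π (m y) ∧ s (m y) = pc c)) := by
    rintro c y hy hsy (h | h)
    · rw [hsy] at h; exact pn _ _ h.2.symm
    · refine nocon c (m y) h.1 h.2 (by rwa [S.inv]) ?_
      rw [S.inv]; exact Or.inr hsy
  refine ⟨lab π m s, ?_, ?_, ?_⟩
  · intro x
    simp only [lab, S.inv, or_comm]
  · intro x
    unfold lab; split_ifs <;> simp
  · intro v hv
    obtain ⟨w, τ, c, hτ, hw, hf, hws⟩ := hs v hv
    refine ⟨w, τ, hτ, hw, ?_⟩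
    have h1 := hw.trans (hτ.sc _)
    have h2 := h1.trans (hτ.sc _)
    have h3 := h2.trans (hτ.sc _)
    have ho : ∀ {y}, π.SameCycle v y → OddV π y := fun hy => (sameCycle_oddV hy).1 hv
    have Sτ := S.dir hτ
    have n2 : τ (τ w) ≠ w := (hτ.oddV.2 (ho hw)).ne2 Sτ
    have s0 : s w = pc c := by rw [hws _ hw]; simp [ws]
    have s1 : s (τ w) = pc c := by rw [hws _ h1]; simp [ws]
    have s2 : s (τ (τ w)) = nc c := by
      rw [hws _ h2]; unfold ws
      rw [if_neg, if_pos (Or.inl rfl)]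
      rintro (h | h)
      · exact n2 h
      · exact Sτ.p1 _ h
    have s3 : s (τ (τ (τ w))) = nc c := by
      rw [hws _ h3]; unfold ws
      rw [if_neg, if_pos (Or.inr rfl)]
      rintro (h | h)
      · exact Sτ.p3 _ h
      · exact n2 (τ.injective h)
    have far0 : ∀ y, OddV π y → s y = nc false → lab π m s y ≠ 0 := by
      intro y hy hsy
      have := near false y hy hsy
      change ¬ ((OddV π y ∧ s y = 0) ∨ (OddV π (m y) ∧ s (m y) = 0)) at this
      unfold lab
      rw [if_neg this]
      split_ifs <;> simp
    have far2 : ∀ y, OddV π y → s y = nc true → lab π m s y ≠ 2 := by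
      intro y hy hsy
      have := near true y hy hsy
      change ¬ ((OddV π y ∧ s y = 1) ∨ (OddV π (m y) ∧ s (m y) = 1)) at this
      unfold lab
      rw [if_neg this]
      split_ifs <;> simp
    have pick0 : ∀ y, OddV π y → s y = pc false → lab π m s y = 0 := by
      intro y hy hsy
      unfold lab
      rw [if_pos (Or.inl ⟨hy, hsy⟩)]
    have pick2 : ∀ y, OddV π y → s y = pc true → lab π m s y = 2 := by
      intro y hy hsy
      unfold lab
      rw [if_neg, if_pos (Or.inl ⟨hy, hsy⟩)]
      rintro (h | h)
      · rw [hsy] at h; exact absurd h.2 (by decide)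
      · exact nocon true y hy hsy h.1 (Or.inl h.2)
    cases c
    · exact Or.inl ⟨pick0 _ (ho hw) s0, pick0 _ (ho h1) s1, far0 _ (ho h2) s2, far0 _ (ho h3) s3⟩
    · exact Or.inr ⟨pick2 _ (ho hw) s0, pick2 _ (ho h1) s1, far2 _ (ho h2) s2, far2 _ (ho h3) s3⟩

/-- Circular distance at least three modulo eleven. -/
def ok (a b : ℕ) : Prop := (a + 3 ≤ b ∧ b ≤ a + 8) ∨ (b + 3 ≤ a ∧ a ≤ b + 8)

/-- Colours `a`, `b` of the two cycle edges and `l` of the matching edge at a vertex fit. -/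
def Fit (a b l : ℕ) : Prop := a < 11 ∧ b < 11 ∧ ok a b ∧ ok a l ∧ ok b l

lemma Fit.symm {a b l : ℕ} (h : Fit a b l) : Fit b a l := by
  unfold Fit ok at *; omega

lemma color_orbit (τ : Equiv.Perm V) (w : V) (l : V → ℕ) (g : ℕ → ℕ)
    (h0 : Fit (g 0) (g (Function.minimalPeriod τ w - 1)) (l w))
    (hs : ∀ i, i + 1 < Function.minimalPeriod τ w →
      Fit (g (i+1)) (g i) (l ((τ ^ (i+1)) w))) :
    ∃ k : V → ℕ, ∀ x, τ.SameCycle w x → Fit (k x) (k (τ⁻¹ x)) (l x) := by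
  classical
  have hper : w ∈ Function.periodicPts τ := Function.mem_periodicPts.2
      ⟨orderOf τ, orderOf_pos τ, by
        rw [Function.IsPeriodicPt, Function.IsFixedPt, ← Equiv.Perm.coe_pow, pow_orderOf_eq_one]
        rfl⟩
  set n := Function.minimalPeriod τ w with hn
  have hpos : 0 < n := Function.minimalPeriod_pos_of_mem_periodicPts hper
  have hcyc : (τ ^ n) w = w := by
    rw [Equiv.Perm.coe_pow]; exact Function.isPeriodicPt_minimalPeriod τ w
  have hex : ∀ x, τ.SameCycle w x → ∃ i, i < n ∧ (τ ^ i) w = x := by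
    intro x hx
    obtain ⟨i, -, hi⟩ := hx.exists_pow_eq'
    refine ⟨i % n, Nat.mod_lt _ hpos, ?_⟩
    rw [← hi, Equiv.Perm.coe_pow, Equiv.Perm.coe_pow, Function.iterate_mod_minimalPeriod_eq]
  have hinj : ∀ i j, i < n → j < n → (τ ^ i) w = (τ ^ j) w → i = j := by
    intro i j hi hj h
    rw [Equiv.Perm.coe_pow, Equiv.Perm.coe_pow] at h
    exact (Function.iterate_eq_iterate_iff_of_lt_minimalPeriod hi hj).1 h
  let k : V → ℕ := fun x => if h : ∃ i, i < n ∧ (τ ^ i) w = x then g h.choose else 0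
  have hk : ∀ i, i < n → k ((τ ^ i) w) = g i := by
    intro i hi
    have h : ∃ j, j < n ∧ (τ ^ j) w = (τ ^ i) w := ⟨i, hi, rfl⟩
    have : k ((τ ^ i) w) = g h.choose := dif_pos h
    rw [this, hinj _ _ h.choose_spec.1 hi h.choose_spec.2]
  refine ⟨k, fun x hx => ?_⟩
  obtain ⟨i, hi, rfl⟩ := hex x hx
  rw [hk i hi]
  rcases i with _ | i
  · have e : τ⁻¹ ((τ ^ 0) w) = (τ ^ (n - 1)) w := by
      rw [Equiv.Perm.inv_eq_iff_eq, ← Equiv.Perm.mul_apply, ← pow_succ', Nat.sub_add_cancel hpos,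
        hcyc]; rfl
    rw [e, hk _ (by omega)]
    simpa using h0
  · have e : τ⁻¹ ((τ ^ (i+1)) w) = (τ ^ i) w := by
      rw [Equiv.Perm.inv_eq_iff_eq, pow_succ']; rfl
    rw [e, hk _ (by omega)]
    exact hs i hi

lemma color_dir {π τ : Equiv.Perm V} (hτ : Dir π τ) (v : V) (l : V → ℕ)
    (h : ∃ k : V → ℕ, ∀ x, τ.SameCycle v x → Fit (k x) (k (τ⁻¹ x)) (l x)) :
    ∃ k : V → ℕ, ∀ x, π.SameCycle v x → Fit (k x) (k (π⁻¹ x)) (l x) := by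
  rcases hτ with rfl | rfl
  · exact h
  · obtain ⟨k, hk⟩ := h
    refine ⟨fun x => k (π x), fun x hx => ?_⟩
    have := hk x (Equiv.Perm.sameCycle_inv.2 hx)
    rw [inv_inv] at this
    simpa using this.symm

def g0 : ℕ → ℕ
  | 0 => 3
  | 1 => 6
  | 2 => 9
  | n + 3 => if Even n then 5 else 8

def g2 : ℕ → ℕ
  | 0 => 10
  | 1 => 7
  | 2 => 4
  | n + 3 => if Even n then 8 else 5

lemma exists_colors {π : Equiv.Perm V} {m : V → V} (S : Setup π m) :
    ∃ l k : V → ℕ, (∀ x, l (m x) = l x) ∧ (∀ x, l x ≤ 2) ∧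
      ∀ x, Fit (k x) (k (π⁻¹ x)) (l x) := by
  classical
  obtain ⟨l, hl1, hl2, hl3⟩ := exists_labels S
  have main : ∀ v, ∃ k : V → ℕ, ∀ x, π.SameCycle v x → Fit (k x) (k (π⁻¹ x)) (l x) := by
    intro v
    by_cases hv : OddV π v
    · obtain ⟨w, τ, hτ, hw, hl⟩ := hl3 v hv
      suffices h : ∃ k : V → ℕ, ∀ x, τ.SameCycle w x → Fit (k x) (k (τ⁻¹ x)) (l x) by
        obtain ⟨k, hk⟩ := color_dir hτ w l h
        exact ⟨k, fun x hx => hk x (hw.symm.trans hx)⟩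
      have Sτ := S.dir hτ
      have ho : Odd (Function.minimalPeriod τ w) := hτ.oddV.2 ((sameCycle_oddV hw).1 hv)
      have n1 : Function.minimalPeriod τ w ≠ 1 := fun h =>
        Sτ.p1 w (Function.minimalPeriod_eq_one_iff_isFixedPt.1 h)
      have n3 : Function.minimalPeriod τ w ≠ 3 := fun h =>
        Sτ.p3 w (by have := Function.isPeriodicPt_minimalPeriod τ w; rw [h] at this; exact this)
      obtain ⟨r, hr⟩ := ho
      have hr2 : 2 ≤ r := by omega
      obtain ⟨q, rfl⟩ := Nat.exists_eq_add_of_le hr2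
      have e1 : (τ ^ 1) w = τ w := rfl
      have e2 : (τ ^ 2) w = τ (τ w) := rfl
      have e3 : (τ ^ 3) w = τ (τ (τ w)) := rfl
      have b2 := hl2 (τ (τ w))
      have b3 := hl2 (τ (τ (τ w)))
      rcases hl with ⟨a0, a1, a2, a3⟩ | ⟨a0, a1, a2, a3⟩
      · refine color_orbit τ w l g0 ?_ ?_
        · rw [hr, show 2 * (2 + q) + 1 - 1 = (2 * q + 1) + 3 by omega, a0]
          simp [g0, Fit, ok]
        · intro i hi
          rcases i with _ | _ | _ | i
          · simp only [zero_add, e1, a1]; simp [g0, Fit, ok]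
          · simp only [zero_add, Nat.reduceAdd, e2]; simp only [g0, Fit, ok]; omega
          · simp only [zero_add, Nat.reduceAdd, e3]; simp only [g0, Fit, ok]; simp; omega
          · have := hl2 ((τ ^ (i + 1 + 1 + 1 + 1)) w)
            simp only [g0, Nat.even_add_one]
            by_cases he : Even i <;> simp only [he, Fit, ok] <;> simp <;> omega
      · refine color_orbit τ w l g2 ?_ ?_
        · rw [hr, show 2 * (2 + q) + 1 - 1 = (2 * q + 1) + 3 by omega, a0]
          simp [g2, Fit, ok]
        · intro i hi
          rcases i with _ | _ | _ | i
          · simp only [zero_add, e1, a1]; simp [g2, Fit, ok]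
          · simp only [zero_add, Nat.reduceAdd, e2]; simp only [g2, Fit, ok]; omega
          · simp only [zero_add, Nat.reduceAdd, e3]; simp only [g2, Fit, ok]; simp; omega
          · have := hl2 ((τ ^ (i + 1 + 1 + 1 + 1)) w)
            simp only [g2, Nat.even_add_one]
            by_cases he : Even i <;> simp only [he, Fit, ok] <;> simp <;> omega
    · have he : Even (Function.minimalPeriod π v) := Nat.not_odd_iff_even.1 hv
      have hpos : 0 < Function.minimalPeriod π v :=
        Function.minimalPeriod_pos_of_mem_periodicPts (Function.mem_periodicPts.2
          ⟨orderOf π, orderOf_pos π, by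
            rw [Function.IsPeriodicPt, Function.IsFixedPt, ← Equiv.Perm.coe_pow,
              pow_orderOf_eq_one]
            rfl⟩)
      refine color_orbit π v l (fun i => if Even i then 5 else 8) ?_ ?_
      · have : ¬ Even (Function.minimalPeriod π v - 1) := by
          rw [Nat.even_sub hpos]; simp [he]
        have := hl2 v
        simp only [*, Fit, ok]; simp; omega
      · intro i _
        have := hl2 ((π ^ (i + 1)) v)
        simp only [Nat.even_add_one]
        by_cases he : Even i <;> simp only [he, Fit, ok] <;> simp <;> omega
  have main' : ∀ q : Quotient (Equiv.Perm.SameCycle.setoid π), ∃ k : V → ℕ,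
      ∀ x, Quotient.mk _ x = q → Fit (k x) (k (π⁻¹ x)) (l x) := by
    intro q
    obtain ⟨v, rfl⟩ := Quotient.exists_rep q
    obtain ⟨k, hk⟩ := main v
    exact ⟨k, fun x hx => hk x (Equiv.Perm.SameCycle.symm (Quotient.exact hx))⟩
  choose k hk using main'
  refine ⟨l, fun x => k (Quotient.mk _ x) x, hl1, hl2, fun x => ?_⟩
  have : Quotient.mk (Equiv.Perm.SameCycle.setoid π) (π⁻¹ x) = Quotient.mk _ x :=
    Quotient.sound (by
      change π.SameCycle _ _
      exact ⟨1, by simp⟩)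
  simp only [this]
  exact hk _ x rfl

end Perm

end CubicEleven

open CubicEleven in
theorem circular_chromatic_index_le_eleven_thirds_of_cubic_girth_four
    {V : Type*} [Fintype V] [DecidableEq V] (G : SimpleGraph V) [DecidableRel G.Adj]
    (hcubic : ∀ v, G.degree v = 3)
    (hgirth : 4 ≤ G.egirth)
    (hM : ∃ M : G.Subgraph, M.IsPerfectMatching) :
    ∃ f, IsPQColoring G.lineGraph 11 3 f := by
  obtain ⟨M, hM⟩ := hM
  have htri : ∀ a b c, G.Adj a b → G.Adj b c → G.Adj a c → False := by
    intro a b c hab hbc hac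
    have h3 : G.IsNClique 3 {a, b, c} := is3Clique_triple_iff.2 ⟨hab, hac, hbc⟩
    obtain ⟨u, w, hw, hl⟩ := (is3Clique_iff_exists_cycle_length_three).1 ⟨_, h3⟩
    have := (le_egirth.1 hgirth) u w hw
    rw [hl] at this
    exact absurd this (by decide)
  have hm : ∀ v, ∃ w, M.Adj v w ∧ ∀ y, M.Adj v y → y = w := by
    intro v
    obtain ⟨w, hw, hu⟩ := hM.1 (hM.2 v)
    exact ⟨w, hw, hu⟩
  choose m hm1 hm2 using hm
  have hGm : ∀ x, G.Adj x (m x) := fun x => (hm1 x).adj_sub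
  have minv : ∀ x, m (m x) = x := fun x => (hm2 _ _ (hm1 x).symm).symm
  let N : V → Finset V := fun x => (G.neighborFinset x).erase (m x)
  have hN : ∀ x y, y ∈ N x ↔ (y ≠ m x ∧ G.Adj x y) := by intro x y; simp [N]
  have hNs : ∀ x y, y ∈ N x → x ∈ N y := by
    intro x y h
    rw [hN] at *
    refine ⟨fun h' => h.1 ?_, h.2.symm⟩
    rw [h', minv]
  have hNc : ∀ x, (N x).card = 2 := by
    intro x
    have := Finset.card_erase_of_mem (show m x ∈ G.neighborFinset x by simpa using hGm x)
    rw [G.card_neighborFinset_eq_degree, hcubic] at this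
    exact this
  obtain ⟨p, hpinj, hpN⟩ := (Finset.all_card_le_biUnion_card_iff_exists_injective N).1 (by
    intro A
    have := Finset.card_mul_le_card_mul (s := A) (t := A.biUnion N) (m := 2) (n := 2)
      (fun x y => y ∈ N x) (by
        intro a ha
        rw [← hNc a]
        apply Finset.card_le_card
        intro y hy
        simp only [Finset.mem_bipartiteAbove, Finset.mem_biUnion]
        exact ⟨⟨a, ha, hy⟩, hy⟩) (by
        intro b _
        rw [← hNc b]
        apply Finset.card_le_card
        intro x hx
        simp only [Finset.mem_bipartiteBelow] at hx
        exact hNs _ _ hx.2)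
    omega)
  let π : Equiv.Perm V := Equiv.ofBijective p (Finite.injective_iff_bijective.1 hpinj)
  have hπN : ∀ x, π x ∈ N x := hpN
  have hπA : ∀ x, G.Adj x (π x) := fun x => ((hN _ _).1 (hπN x)).2
  have S : Setup π m :=
    { inv := minv
      m1 := fun x h => ((hN _ _).1 (hπN x)).1 h.symm
      m2 := fun x h => htri x (π x) (π (π x)) (hπA _) (hπA _) (h ▸ hGm x)
      p1 := fun x h => (hπA x).ne h.symm
      p3 := fun x h => htri x (π x) (π (π x)) (hπA _) (hπA _) (by
        have := hπA (π (π x))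
        rw [h] at this
        exact this.symm) }
  obtain ⟨l, k, hl1, hl2, hk⟩ := exists_colors S
  have hinvN : ∀ x, π⁻¹ x ∈ N x := fun x => hNs _ _ (by
    have := hπN (π⁻¹ x)
    simpa using this)
  have hNeq : ∀ x, π (π x) ≠ x → ∀ y, y ∈ N x → y = π x ∨ y = π⁻¹ x := by
    intro x hx y hy
    have hne : π x ≠ π⁻¹ x := by
      intro h; apply hx; rw [h]; simp
    have : N x = {π x, π⁻¹ x} := by
      symm
      apply Finset.eq_of_subset_of_card_le
      · intro z hz
        simp only [Finset.mem_insert, Finset.mem_singleton] at hz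
        rcases hz with rfl | rfl
        · exact hπN x
        · exact hinvN x
      · rw [hNc, Finset.card_pair hne]
    rw [this] at hy
    simpa using hy
  have hN2 : ∀ x y z, y ∈ N x → z ∈ N x → y ≠ π x → z ≠ π x → y = z := by
    intro x y z hy hz hy' hz'
    by_contra hne
    have : ({π x, y, z} : Finset V).card ≤ (N x).card := by
      apply Finset.card_le_card
      intro u hu
      simp only [Finset.mem_insert, Finset.mem_singleton] at hu
      rcases hu with rfl | rfl | rfl
      · exact hπN x
      · exact hy
      · exact hz
    rw [hNc, Finset.card_eq_three.2 ⟨π x, y, z, hy'.symm, hz'.symm, hne, rfl⟩] at this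
    omega
  let col : V → V → ℕ := fun a b => if m a = b then l a else if π (π a) = a then
    (if π a = b then 5 else 8) else if π a = b then k a else k b
  have hS : ∀ a b, b ∈ N a → π (π a) = a → π (π b) = b := by
    intro a b hb ha
    by_contra hbb
    rcases hNeq b hbb a (hNs _ _ hb) with h | h
    · apply hbb; rw [← h]
      have : π (π (π b)) = π b := by rw [← h]; exact ha
      rw [h]; exact π.injective this
    · apply hbb
      have : π a = b := by rw [h]; simp
      rw [← this, ha]
  have hcs : ∀ a b, G.Adj a b → col a b = col b a := by
    intro a b hab
    by_cases hmab : m a = b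
    · have hmba : m b = a := by rw [← hmab, minv]
      simp only [col, if_pos hmab, if_pos hmba]
      rw [← hmab, hl1]
    · have hmba : ¬ m b = a := fun h => hmab (by rw [← h, minv])
      have hb : b ∈ N a := (hN _ _).2 ⟨fun h => hmab h.symm, hab⟩
      have ha := hNs _ _ hb
      simp only [col, if_neg hmab, if_neg hmba]
      by_cases h2 : π (π a) = a
      · have h2' := hS a b hb h2
        simp only [if_pos h2, if_pos h2']
        by_cases h : π a = b
        · have : π b = a := by rw [← h, h2]
          simp [h, this]
        · have : ¬ π b = a := fun h' => h (by rw [← h', h2'])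
          simp [h, this]
      · have h2' : ¬ π (π b) = b := fun h => h2 (hS b a ha h)
        simp only [if_neg h2, if_neg h2']
        rcases hNeq a h2 b hb with h | h
        · have : ¬ π b = a := fun h' => h2 (by rw [← h, h'])
          simp [h.symm, this]
        · have h3 : π b = a := by rw [h]; simp
          have : ¬ π a = b := fun h' => h2 (by rw [h', h3])
          simp [h3, this]
  have hc11 : ∀ a b, col a b < 11 := by
    intro a b
    have h1 := hl2 a
    have h2 := (hk a).1
    have h3 := (hk b).1
    simp only [col]
    split_ifs <;> omega
  have oks : ∀ a b, ok a b → ok b a := by intro a b h; unfold ok at *; omega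
  have hmain : ∀ x a b, G.Adj x a → G.Adj x b → a ≠ b → ok (col x a) (col x b) := by
    intro x a b ha hb hab
    have hlx := hl2 x
    obtain ⟨-, -, k1, k2, k3⟩ := hk x
    have hmv : ∀ y, y ∈ N x → ¬ m x = y := fun y hy h => ((hN _ _).1 hy).1 h.symm
    have hml : ∀ y, y ∈ N x → ok (l x) (col x y) := by
      intro y hy
      simp only [col, if_neg (hmv y hy)]
      by_cases h2 : π (π x) = x
      · rw [if_pos h2]
        split_ifs <;> (unfold ok; omega)
      · rw [if_neg h2]
        split_ifs with h
        · exact oks _ _ k2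
        · rcases hNeq x h2 y hy with h' | h'
          · exact absurd h'.symm h
          · rw [h']; exact oks _ _ k3
    have hnn : ∀ y, y ∈ N x → y ≠ π x → ok (col x (π x)) (col x y) := by
      intro y hy hne
      simp only [col, if_neg (hmv y hy), if_neg (hmv _ (hπN x)), if_neg hne.symm, if_true]
      by_cases h2 : π (π x) = x
      · simp only [if_pos h2]; unfold ok; omega
      · simp only [if_neg h2]
        rcases hNeq x h2 y hy with h' | h'
        · exact absurd h' hne
        · rw [h']; exact k1
    by_cases hma : m x = a
    · have : b ∈ N x := (hN _ _).2 ⟨fun h => hab (by rw [← hma, h]), hb⟩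
      have := hml b this
      have e : col x a = l x := by simp [col, hma]
      rwa [e]
    · have haN : a ∈ N x := (hN _ _).2 ⟨fun h => hma h.symm, ha⟩
      by_cases hmb : m x = b
      · have e : col x b = l x := by simp [col, hmb]
        rw [e]; exact oks _ _ (hml a haN)
      · have hbN : b ∈ N x := (hN _ _).2 ⟨fun h => hmb h.symm, hb⟩
        by_cases h1 : a = π x
        · subst h1; exact hnn b hbN hab.symm
        · by_cases h2 : b = π x
          · subst h2; exact oks _ _ (hnn a haN hab)
          · exact absurd (hN2 x a b haN hbN h1 h2) hab
  let F : Sym2 V → ℕ := Sym2.lift ⟨fun a b => if G.Adj a b then col a b else 0, by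
    intro a b
    by_cases h : G.Adj a b
    · simp only [h, h.symm, if_true]; exact hcs a b h
    · have h' : ¬ G.Adj b a := fun h' => h h'.symm
      simp only [h, h', if_false]⟩
  have hF : ∀ a b, G.Adj a b → F s(a, b) = col a b := by
    intro a b h
    simp [F, h]
  refine ⟨fun e => F e.1, ?_, ?_⟩
  · rintro ⟨e, he⟩
    induction e with
    | _ a b =>
      rw [SimpleGraph.mem_edgeSet] at he
      simp only [hF a b he]
      exact hc11 a b
  · rintro ⟨e, he⟩ ⟨e', he'⟩ hadj
    obtain ⟨hne, x, hx, hx'⟩ := (SimpleGraph.lineGraph_adj_iff_exists).1 hadj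
    simp only at hx hx'
    obtain ⟨a, rfl⟩ := Sym2.mem_iff_exists.1 hx
    obtain ⟨b, rfl⟩ := Sym2.mem_iff_exists.1 hx'
    rw [SimpleGraph.mem_edgeSet] at he he'
    have hab : a ≠ b := by
      rintro rfl; exact hne rfl
    have := hmain x a b he he' hab
    simp only [hF _ _ he, hF _ _ he']
    unfold ok at this
    rw [le_abs', abs_le]
    push_cast
    omega
end
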